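/- Let g ≥ 5 be a prime and k ≥ 1 a real number. For every ε > 0 there exists a constant C = C(g, k, ε) such that for all real X ≥ 2, the sum of h_g(-d)^k over squarefree integers d with 0 < d < X is at most: C · X^{1 + k(g-2)/(2g+2) + ε} if 1 ≤ k ≤ (g²-1)/(2g-1); C · X^{1 + k(g-1)/(2g) - (g-1)/(2g) + ε} if (g²-1)/(2g-1) ≤ k ≤ g+1; and C · X^{k/2 + ε} if k ≥ g+1. -/

import Mathlib

/-- The imaginary quadratic field `ℚ(√-d)`, realized as the subfield of `ℂ`
generated over `ℚ` by `√d · i`. -/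
noncomputable def Kneg (d : ℕ) : IntermediateField ℚ ℂ :=
  IntermediateField.adjoin ℚ {(Real.sqrt d : ℂ) * Complex.I}

/-- `hneg g d` is the `g`-part of the class number of `ℚ(√-d)`: the number of
ideal classes `c` of the ring of integers of `ℚ(√-d)` with `c ^ g = 1`. -/
noncomputable def hneg (g d : ℕ) : ℕ :=
  Nat.card {c : ClassGroup (NumberField.RingOfIntegers (Kneg d)) // c ^ g = 1}

/-- Integers that are pairwise congruent modulo `m` and lie in an interval of length `L`. -/
theorem Finset.card_le_of_dvd_sub (T : Finset ℤ) {m : ℕ} (hm : 0 < m) {L : ℝ} (hL : 0 ≤ L)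
    (hdvd : ∀ x ∈ T, ∀ y ∈ T, (m : ℤ) ∣ x - y) (hlen : ∀ x ∈ T, ∀ y ∈ T, (x : ℝ) - y ≤ L) :
    (T.card : ℝ) ≤ L / m + 1 := by
  rcases T.eq_empty_or_nonempty with rfl | hT
  · simp; positivity
  have hm' : (0 : ℝ) < m := by exact_mod_cast hm
  have hmz : (0 : ℤ) < m := by exact_mod_cast hm
  set y := T.min' hT
  have hy : y ∈ T := T.min'_mem hT
  have hcard : T.card ≤ (Finset.range (⌊L / m⌋₊ + 1)).card := by
    apply Finset.card_le_card_of_injOn (fun x => ((x - y) / m).toNat)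
    · intro x hx
      have hx : x ∈ T := hx
      obtain ⟨c, hc⟩ := hdvd x hx y hy
      have hyx : y ≤ x := T.min'_le x hx
      have hc0 : 0 ≤ c := by
        by_contra! h
        nlinarith
      have h2 : (x - y) / m = c := by rw [hc]; exact Int.mul_ediv_cancel_left _ hmz.ne'
      simp only [Finset.coe_range, Set.mem_Iio, h2]
      refine Nat.lt_succ_of_le (Nat.le_floor ?_)
      rw [le_div_iff₀ hm']
      have h3 := hlen x hx y hy
      have h4 : ((x - y : ℤ) : ℝ) = m * c := by rw [hc]; push_cast; ring
      have h5 : ((c.toNat : ℕ) : ℝ) = c := by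
        have : ((c.toNat : ℕ) : ℤ) = c := Int.toNat_of_nonneg hc0
        exact_mod_cast this
      rw [h5]
      push_cast at h4
      linarith
    · intro x hx x' hx' h
      have hx : x ∈ T := hx
      have hx' : x' ∈ T := hx'
      obtain ⟨c, hc⟩ := hdvd x hx y hy
      obtain ⟨c', hc'⟩ := hdvd x' hx' y hy
      have hyx : y ≤ x := T.min'_le x hx
      have hyx' : y ≤ x' := T.min'_le x' hx'
      have hc0 : 0 ≤ c := by
        by_contra! h
        nlinarith
      have hc0' : 0 ≤ c' := by
        by_contra! h
        nlinarith
      simp only [hc, hc', Int.mul_ediv_cancel_left _ hmz.ne'] at h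
      have : c = c' := by omega
      subst this
      linarith
  rw [Finset.card_range] at hcard
  calc (T.card : ℝ) ≤ ((⌊L / m⌋₊ + 1 : ℕ) : ℝ) := by exact_mod_cast hcard
    _ ≤ L / m + 1 := by
      push_cast
      have := Nat.floor_le (show 0 ≤ L / m by positivity)
      linarith

/-- Square roots of `D` modulo `n` in an interval of length `L`. -/
theorem card_sq_modEq_le {n : ℕ} (hn : 0 < n) (D : ℤ) {L : ℝ} (hL : 0 ≤ L) (G : ℕ) (S : Finset ℤ)
    (hroot : ∀ x ∈ S, (n : ℤ) ∣ x ^ 2 - D)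
    (hlen : ∀ x ∈ S, ∀ y ∈ S, (x : ℝ) - y ≤ L)
    (hG : ∀ x ∈ S, ∀ e : ℕ, (e : ℤ) ∣ 2 * x → e ^ 2 ∣ n → e ≤ G) :
    (S.card : ℝ) ≤ n.divisors.card * (G * L / n + 1) := by
  rcases S.eq_empty_or_nonempty with rfl | ⟨x₀, hx₀⟩
  · simp; positivity
  have hmaps : ∀ x ∈ S, Int.gcd (x - x₀) n ∈ n.divisors := by
    intro x _
    rw [Nat.mem_divisors]
    refine ⟨?_, hn.ne'⟩
    have := Int.gcd_dvd_right (x - x₀) (n : ℤ)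
    exact_mod_cast this
  rw [Finset.card_eq_sum_card_fiberwise hmaps]
  push_cast
  have key : ∀ e ∈ n.divisors,
      ((S.filter (fun x => Int.gcd (x - x₀) n = e)).card : ℝ) ≤ G * L / n + 1 := by
    intro e he
    obtain ⟨f, hf⟩ := (Nat.mem_divisors.mp he).1
    rcases (S.filter (fun x => Int.gcd (x - x₀) n = e)).eq_empty_or_nonempty with h0 | ⟨x₁, hx₁⟩
    · rw [h0]; simp; positivity
    have hepos : 0 < e := Nat.pos_of_mul_pos_right (hf ▸ hn)
    have hfpos : 0 < f := Nat.pos_of_mul_pos_left (hf ▸ hn)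
    have hprop : ∀ x ∈ S.filter (fun x => Int.gcd (x - x₀) n = e),
        (e : ℤ) ∣ x - x₀ ∧ (f : ℤ) ∣ x + x₀ := by
      intro x hx
      rw [Finset.mem_filter] at hx
      have h1 : (e : ℤ) ∣ x - x₀ := by
        rw [← hx.2]; exact Int.gcd_dvd_left _ _
      refine ⟨h1, ?_⟩
      have h2 : (n : ℤ) ∣ (x - x₀) * (x + x₀) := by
        have := dvd_sub (hroot x hx.1) (hroot x₀ hx₀)
        exact this.imp fun u hu => by linear_combination hu
      obtain ⟨u, hu⟩ := h1
      have h3 : IsCoprime (f : ℤ) u := by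
        rw [Int.isCoprime_iff_gcd_eq_one]
        have h4 := hx.2
        rw [hu, hf] at h4
        push_cast at h4
        rw [Int.gcd_mul_left] at h4
        simp only [Int.natAbs_natCast] at h4
        have : Int.gcd u f = 1 := by
          apply Nat.eq_of_mul_eq_mul_left hepos
          rw [h4, mul_one]
        rw [Int.gcd_comm]; exact this
      rw [hu, hf] at h2
      push_cast at h2
      rw [mul_assoc] at h2
      have h5 : (f : ℤ) ∣ u * (x + x₀) :=
        Int.dvd_of_mul_dvd_mul_left (by exact_mod_cast hepos.ne') h2
      exact h3.dvd_of_dvd_mul_left h5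
    set c := Nat.gcd e f with hc
    have hcpos : 0 < c := Nat.gcd_pos_of_pos_left _ hepos
    have hcn : c ^ 2 ∣ n := by
      rw [hf, sq]; exact mul_dvd_mul (Nat.gcd_dvd_left _ _) (Nat.gcd_dvd_right _ _)
    have hcG : c ≤ G := by
      apply hG x₀ hx₀ c _ hcn
      have h1 : (c : ℤ) ∣ x₁ - x₀ :=
        (Int.natCast_dvd_natCast.mpr (Nat.gcd_dvd_left _ _)).trans (hprop x₁ hx₁).1
      have h2 : (c : ℤ) ∣ x₁ + x₀ :=
        (Int.natCast_dvd_natCast.mpr (Nat.gcd_dvd_right _ _)).trans (hprop x₁ hx₁).2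
      have := dvd_sub h2 h1
      exact this.imp fun u hu => by linear_combination hu
    have hlcm : 0 < Nat.lcm e f := Nat.lcm_pos hepos hfpos
    have h1 := Finset.card_le_of_dvd_sub (S.filter (fun x => Int.gcd (x - x₀) n = e)) hlcm hL
      (by
        intro x hx y hy
        have h1 : (e : ℤ) ∣ x - y := by
          have := dvd_sub (hprop x hx).1 (hprop y hy).1
          exact this.imp fun u hu => by linear_combination hu
        have h2 : (f : ℤ) ∣ x - y := by
          have := dvd_sub (hprop x hx).2 (hprop y hy).2
          exact this.imp fun u hu => by linear_combination hu
        rw [Int.natCast_dvd] at h1 h2 ⊢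
        exact Nat.lcm_dvd h1 h2)
      (by
        intro x hx y hy
        exact hlen x (Finset.mem_filter.mp hx).1 y (Finset.mem_filter.mp hy).1)
    refine h1.trans ?_
    have hprod : (c : ℝ) * Nat.lcm e f = n := by
      rw [hf]; exact_mod_cast Nat.gcd_mul_lcm e f
    have hl' : (0 : ℝ) < Nat.lcm e f := by exact_mod_cast hlcm
    have hc' : (0 : ℝ) < c := by exact_mod_cast hcpos
    have hcG' : (c : ℝ) ≤ G := by exact_mod_cast hcG
    have : L / Nat.lcm e f ≤ G * L / n := by
      rw [← hprod, div_le_div_iff₀ hl' (by positivity)]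
      have : L * (c * Nat.lcm e f) = c * (L * Nat.lcm e f) := by ring
      rw [this]
      have : G * L * Nat.lcm e f = G * (L * Nat.lcm e f) := by ring
      rw [this]
      gcongr
    linarith
  calc _ ≤ ∑ e ∈ n.divisors, ((G * L / n + 1 : ℝ)) := Finset.sum_le_sum key
    _ = _ := by rw [Finset.sum_const, nsmul_eq_mul]

/-- The divisor bound. -/
theorem exists_card_divisors_le_rpow {η : ℝ} (hη : 0 < η) :
    ∃ C : ℝ, 1 ≤ C ∧ ∀ n : ℕ, 0 < n → (n.divisors.card : ℝ) ≤ C * (n : ℝ) ^ η := by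
  set B : ℝ := max 1 (1 / (η * Real.log 2)) with hB
  have hB1 : 1 ≤ B := le_max_left _ _
  have hlog : 0 < Real.log 2 := Real.log_pos (by norm_num)
  set M : ℕ := ⌈(2 : ℝ) ^ (1 / η)⌉₊ with hM
  have hstep : ∀ p a : ℕ, p.Prime → ((a : ℝ) + 1) ≤ (if p < M then B else 1) * ((p : ℝ) ^ a) ^ η := by
    intro p a hp
    have hp2 : (2 : ℝ) ≤ p := by exact_mod_cast hp.two_le
    have hp0 : (0 : ℝ) ≤ p := by linarith
    have hcomm : ((p : ℝ) ^ a) ^ η = ((p : ℝ) ^ η) ^ a := by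
      rw [← Real.rpow_natCast, ← Real.rpow_natCast, ← Real.rpow_mul hp0, ← Real.rpow_mul hp0, mul_comm]
    rw [hcomm]
    split_ifs with h
    · have h1 : 1 + η * Real.log 2 ≤ (p : ℝ) ^ η := by
        calc 1 + η * Real.log 2 ≤ Real.exp (η * Real.log 2) := by
              have := Real.add_one_le_exp (η * Real.log 2); linarith
          _ = (2 : ℝ) ^ η := by rw [Real.rpow_def_of_pos (by norm_num)]; ring_nf
          _ ≤ (p : ℝ) ^ η := by gcongr
      have h2 : 1 + a * (η * Real.log 2) ≤ ((p : ℝ) ^ η) ^ a := by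
        calc 1 + a * (η * Real.log 2) ≤ (1 + η * Real.log 2) ^ a :=
              one_add_mul_le_pow (by nlinarith [mul_pos hη hlog]) a
          _ ≤ _ := by gcongr
      have h3 : 1 ≤ B * (η * Real.log 2) := by
        have : 1 / (η * Real.log 2) ≤ B := le_max_right _ _
        rwa [div_le_iff₀ (by positivity)] at this
      calc (a : ℝ) + 1 ≤ B * (1 + a * (η * Real.log 2)) := by
            have : (a : ℝ) * 1 ≤ a * (B * (η * Real.log 2)) := by gcongr
            nlinarith
        _ ≤ _ := by gcongr
    · have h1 : (2 : ℝ) ≤ (p : ℝ) ^ η := by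
        have h2 : (2 : ℝ) ^ (1 / η) ≤ p := by
          have := Nat.le_ceil ((2 : ℝ) ^ (1 / η))
          have h3 : (M : ℝ) ≤ p := by exact_mod_cast (not_lt.mp h)
          linarith
        calc (2 : ℝ) = ((2 : ℝ) ^ (1 / η)) ^ η := by
              rw [← Real.rpow_mul (by norm_num)]; field_simp; simp
          _ ≤ _ := by gcongr
      have h2 : (a : ℝ) + 1 ≤ 2 ^ a := by
        exact_mod_cast Nat.lt_two_pow_self (n := a)
      rw [one_mul]
      exact h2.trans (by gcongr)
  refine ⟨B ^ M, one_le_pow₀ hB1, ?_⟩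
  intro n hn
  rw [Nat.card_divisors hn.ne']
  push_cast
  calc ∏ x ∈ n.primeFactors, ((n.factorization x : ℝ) + 1)
      ≤ ∏ p ∈ n.primeFactors, ((if p < M then B else 1) * ((p : ℝ) ^ (n.factorization p)) ^ η) := by
        apply Finset.prod_le_prod
        · intros; positivity
        · intro p hp; exact hstep p _ (Nat.prime_of_mem_primeFactors hp)
    _ = (∏ p ∈ n.primeFactors, (if p < M then B else 1)) * (n : ℝ) ^ η := by
        rw [Finset.prod_mul_distrib, Real.finsetProd_rpow _ _ (fun i _ => by positivity)]
        congr 2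
        have := Nat.prod_factorization_pow_eq_self hn.ne'
        rw [Finsupp.prod, Nat.support_factorization] at this
        exact_mod_cast this
    _ ≤ B ^ M * (n : ℝ) ^ η := by
        gcongr
        rw [← Finset.prod_filter, Finset.prod_const]
        apply pow_le_pow_right₀ hB1
        calc _ ≤ (Finset.range M).card := by
              apply Finset.card_le_card
              intro p hp
              simp at hp ⊢
              exact hp.2
          _ = M := Finset.card_range M

open NumberField

theorem sqrt_mul_I_sq (d : ℕ) : ((Real.sqrt d : ℂ) * Complex.I) ^ 2 = -(d : ℂ) := by
  rw [mul_pow, Complex.I_sq, ← Complex.ofReal_pow, Real.sq_sqrt (Nat.cast_nonneg d)]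
  push_cast; ring

theorem isIntegral_sqrt_mul_I (d : ℕ) : IsIntegral ℤ ((Real.sqrt d : ℂ) * Complex.I) := by
  apply IsIntegral.of_pow (n := 2) (by norm_num)
  rw [sqrt_mul_I_sq]
  simpa using isIntegral_algebraMap (R := ℤ) (A := ℂ) (x := -(d : ℤ))

instance numberField_Kneg (d : ℕ) : NumberField (Kneg d) where
  to_charZero := inferInstance
  to_finiteDimensional :=
    IntermediateField.adjoin.finiteDimensional
      ((isIntegral_sqrt_mul_I d).tower_top (A := ℚ))

/-- The element `√-d` of `ℚ(√-d)`. -/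
noncomputable def sqrtNegK (d : ℕ) : Kneg d :=
  ⟨(Real.sqrt d : ℂ) * Complex.I, IntermediateField.mem_adjoin_simple_self ℚ _⟩

theorem sqrtNegK_sq (d : ℕ) : sqrtNegK d ^ 2 = -(d : Kneg d) := by
  apply Subtype.ext
  simpa using! sqrt_mul_I_sq d

/-- The integer `√-d` of `ℚ(√-d)`. -/
noncomputable def sqrtNeg (d : ℕ) : 𝓞 (Kneg d) :=
  ⟨sqrtNegK d, by
    apply IsIntegral.of_pow (n := 2) (by norm_num)
    rw [sqrtNegK_sq]
    simpa using isIntegral_algebraMap (R := ℤ) (A := Kneg d) (x := -(d : ℤ))⟩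

theorem sqrtNeg_sq (d : ℕ) : sqrtNeg d ^ 2 = -(d : 𝓞 (Kneg d)) := by
  apply RingOfIntegers.ext
  simpa using! sqrtNegK_sq d

theorem exists_rat_add_mul_sqrtNegK (d : ℕ) (α : Kneg d) :
    ∃ x y : ℚ, α = x + y * sqrtNegK d := by
  have key : ∀ z ∈ Algebra.adjoin ℚ {(Real.sqrt d : ℂ) * Complex.I},
      ∃ x y : ℚ, z = x + y * ((Real.sqrt d : ℂ) * Complex.I) := by
    intro z hz
    induction hz using Algebra.adjoin_induction with
    | mem x hx => exact ⟨0, 1, by rw [Set.mem_singleton_iff.mp hx]; simp⟩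
    | algebraMap r => exact ⟨r, 0, by simp⟩
    | add _ _ _ _ h1 h2 =>
      obtain ⟨x, y, rfl⟩ := h1
      obtain ⟨x', y', rfl⟩ := h2
      exact ⟨x + x', y + y', by push_cast; ring⟩
    | mul _ _ _ _ h1 h2 =>
      obtain ⟨x, y, rfl⟩ := h1
      obtain ⟨x', y', rfl⟩ := h2
      refine ⟨x * x' - d * y * y', x * y' + x' * y, ?_⟩
      push_cast
      linear_combination (y : ℂ) * y' * sqrt_mul_I_sq d
  have hα : (α : ℂ) ∈ Algebra.adjoin ℚ {(Real.sqrt d : ℂ) * Complex.I} := by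
    rw [← IntermediateField.adjoin_simple_toSubalgebra_of_isAlgebraic
      ((isIntegral_sqrt_mul_I d).tower_top (A := ℚ)).isAlgebraic]
    exact α.2
  obtain ⟨x, y, h⟩ := key _ hα
  refine ⟨x, y, Subtype.ext ?_⟩
  rw [h]
  push_cast
  rfl

theorem isIntegral_ratCast_complex {x : ℚ} (h : IsIntegral ℤ (x : ℂ)) : ∃ a : ℤ, x = a := by
  have h' : IsIntegral ℤ (algebraMap ℚ ℂ x) := by simpa using h
  rw [isIntegral_algebraMap_iff (algebraMap ℚ ℂ).injective] at h'
  obtain ⟨a, ha⟩ := IsIntegrallyClosed.isIntegral_iff.mp h'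
  exact ⟨a, by simpa using ha.symm⟩

theorem rat_eq_int_of_sq_mul_squarefree {d : ℕ} (hd : Squarefree d) {r : ℚ} {m : ℤ}
    (h : r ^ 2 * d = m) : ∃ b : ℤ, r = b := by
  have hden : (r.den : ℚ) ≠ 0 := by exact_mod_cast r.den_ne_zero
  have h1 : (r.num : ℤ) ^ 2 * d = m * (r.den : ℤ) ^ 2 := by
    have h2 : (r.num : ℚ) ^ 2 * d = m * (r.den : ℚ) ^ 2 := by
      rw [← h]
      nth_rewrite 2 [← Rat.num_div_den r]
      field_simp
    exact_mod_cast h2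
  have hcop : IsCoprime ((r.den : ℤ) ^ 2) (r.num ^ 2) := by
    apply IsCoprime.pow
    rw [Int.isCoprime_iff_gcd_eq_one, Int.gcd_comm]
    exact r.reduced
  have h3 : ((r.den : ℤ) ^ 2) ∣ d := hcop.dvd_of_dvd_mul_left ⟨m, by rw [h1]; ring⟩
  have h4 : r.den ^ 2 ∣ d := by exact_mod_cast h3
  have h5 : r.den = 1 := by
    have := hd r.den (by rwa [← sq])
    exact Nat.isUnit_iff.mp this
  exact ⟨r.num, by rw [Rat.coe_int_num_of_den_eq_one h5]⟩

theorem exists_two_mul_eq {d : ℕ} (hd : Squarefree d) (α : 𝓞 (Kneg d)) :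
    ∃ a b : ℤ, 2 * α = a + b * sqrtNeg d := by
  obtain ⟨x, y, h⟩ := exists_rat_add_mul_sqrtNegK d α
  have hαi : IsIntegral ℤ (((α : Kneg d) : ℂ)) :=
    (RingOfIntegers.isIntegral_coe α).map (Kneg d).val.toIntAlgHom
  have hC : ((α : Kneg d) : ℂ) = x + y * ((Real.sqrt d : ℂ) * Complex.I) := by
    rw [h]; push_cast; rfl
  have hαi' : IsIntegral ℤ ((starRingEnd ℂ) ((α : Kneg d) : ℂ)) :=
    hαi.map (starRingEnd ℂ).toIntAlgHom
  have hC' : (starRingEnd ℂ) ((α : Kneg d) : ℂ) = x - y * ((Real.sqrt d : ℂ) * Complex.I) := by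
    rw [hC]; simp; ring
  obtain ⟨a, ha⟩ : ∃ a : ℤ, 2 * x = a := by
    apply isIntegral_ratCast_complex
    have := hαi.add hαi'
    rw [hC', hC] at this
    refine (congrArg (IsIntegral ℤ) ?_).mp this
    push_cast; ring
  obtain ⟨m, hm⟩ : ∃ m : ℤ, (2 * y) ^ 2 * d = m := by
    apply isIntegral_ratCast_complex
    have := ((hαi.sub hαi').pow 2).neg
    rw [hC', hC] at this
    refine (congrArg (IsIntegral ℤ) ?_).mp this
    push_cast
    linear_combination -4 * (y : ℂ) ^ 2 * sqrt_mul_I_sq d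
  obtain ⟨b, hb⟩ := rat_eq_int_of_sq_mul_squarefree hd hm
  refine ⟨a, b, RingOfIntegers.ext ?_⟩
  have ha' : (2 * x : Kneg d) = a := by exact_mod_cast congrArg (fun q : ℚ => (q : Kneg d)) ha
  have hb' : (2 * y : Kneg d) = b := by exact_mod_cast congrArg (fun q : ℚ => (q : Kneg d)) hb
  have hs : ((sqrtNeg d : 𝓞 (Kneg d)) : Kneg d) = sqrtNegK d := rfl
  simp only [map_add, map_mul, map_ofNat, map_intCast, hs]
  have h' : algebraMap (𝓞 (Kneg d)) (Kneg d) α = x + y * sqrtNegK d := h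
  rw [h']
  linear_combination ha' + sqrtNegK d * hb'

theorem rat_add_mul_sqrtNegK_eq_zero {d : ℕ} (hd : 0 < d) {x y : ℚ}
    (h : (x : Kneg d) + y * sqrtNegK d = 0) : x = 0 ∧ y = 0 := by
  have hC : (x : ℂ) + y * ((Real.sqrt d : ℂ) * Complex.I) = 0 := by
    have := congrArg (fun z : Kneg d => (z : ℂ)) h
    simpa using! this
  have h0 : (0 : ℝ) < Real.sqrt d := Real.sqrt_pos.mpr (by exact_mod_cast hd)
  have hre := congrArg Complex.re hC
  have him := congrArg Complex.im hC
  simp at hre him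
  refine ⟨by exact_mod_cast hre, ?_⟩
  rcases him with h | h
  · exact_mod_cast h
  · omega

theorem norm_rat_add_mul {d : ℕ} (hd : 0 < d) (x y : ℚ) :
    Algebra.norm ℚ ((x : Kneg d) + y * sqrtNegK d) = x ^ 2 + d * y ^ 2 := by
  have hli : LinearIndependent ℚ ![(1 : Kneg d), sqrtNegK d] := by
    rw [LinearIndependent.pair_iff]
    intro a b h
    apply rat_add_mul_sqrtNegK_eq_zero hd
    rw [← h, Algebra.smul_def, Algebra.smul_def]; simp
  have hspan : ⊤ ≤ Submodule.span ℚ (Set.range ![(1 : Kneg d), sqrtNegK d]) := by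
    intro α _
    obtain ⟨a, b, rfl⟩ := exists_rat_add_mul_sqrtNegK d α
    simp only [Matrix.range_cons, Matrix.range_empty, Set.union_empty, Set.singleton_union]
    rw [Submodule.mem_span_pair]
    exact ⟨a, b, by rw [Algebra.smul_def, Algebra.smul_def]; simp⟩
  let bas := Module.Basis.mk hli hspan
  have hb0 : bas 0 = 1 := by simp [bas]
  have hb1 : bas 1 = sqrtNegK d := by simp [bas]
  have hrep : ∀ u v : ℚ, bas.repr ((u : Kneg d) + v * sqrtNegK d) 0 = u ∧
      bas.repr ((u : Kneg d) + v * sqrtNegK d) 1 = v := by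
    intro u v
    have : (u : Kneg d) + v * sqrtNegK d = u • bas 0 + v • bas 1 := by
      rw [hb0, hb1, Algebra.smul_def, Algebra.smul_def]; simp
    rw [this]
    constructor <;> simp
  rw [Algebra.norm_eq_matrix_det bas, Matrix.det_fin_two]
  simp only [Algebra.leftMulMatrix_eq_repr_mul, hb0, hb1, mul_one]
  have h2 : ((x : Kneg d) + y * sqrtNegK d) * sqrtNegK d
      = ((-(d * y) : ℚ) : Kneg d) + x * sqrtNegK d := by
    push_cast
    linear_combination (y : Kneg d) * sqrtNegK_sq d
  rw [h2, (hrep _ _).1, (hrep _ _).1, (hrep _ _).2, (hrep _ _).2]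
  ring

theorem four_mul_norm {d : ℕ} (hd : 0 < d) {α : 𝓞 (Kneg d)} {a b : ℤ}
    (h : 2 * α = a + b * sqrtNeg d) : 4 * Algebra.norm ℤ α = a ^ 2 + d * b ^ 2 := by
  have h1 : (α : Kneg d) = ((a / 2 : ℚ) : Kneg d) + ((b / 2 : ℚ) : Kneg d) * sqrtNegK d := by
    have h2 := congrArg (fun z : 𝓞 (Kneg d) => (z : Kneg d)) h
    have hs : ((sqrtNeg d : 𝓞 (Kneg d)) : Kneg d) = sqrtNegK d := rfl
    simp only [map_add, map_mul, map_ofNat, map_intCast, hs] at h2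
    push_cast
    linear_combination h2 / 2
  have h3 := Algebra.coe_norm_int α
  rw [h1, norm_rat_add_mul hd] at h3
  have : (4 * Algebra.norm ℤ α : ℚ) = a ^ 2 + d * b ^ 2 := by
    rw [h3]; ring
  exact_mod_cast this

theorem int_add_mul_sqrtNeg_injective {d : ℕ} (hd : 0 < d) {a b a' b' : ℤ}
    (h : (a : 𝓞 (Kneg d)) + b * sqrtNeg d = a' + b' * sqrtNeg d) : a = a' ∧ b = b' := by
  have h2 := congrArg (fun z : 𝓞 (Kneg d) => (z : Kneg d)) h
  have hs : ((sqrtNeg d : 𝓞 (Kneg d)) : Kneg d) = sqrtNegK d := rfl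
  simp only [map_add, map_mul, map_intCast, hs] at h2
  have := rat_add_mul_sqrtNegK_eq_zero hd (x := ((a - a' : ℤ) : ℚ)) (y := ((b - b' : ℤ) : ℚ))
    (by push_cast; linear_combination h2)
  obtain ⟨h3, h4⟩ := this
  constructor
  · have : a - a' = 0 := by exact_mod_cast h3
    omega
  · have : b - b' = 0 := by exact_mod_cast h4
    omega

theorem Ideal.eq_top_of_isCoprime_intCast {R : Type*} [CommRing R] {I : Ideal R} {m n : ℤ}
    (h : IsCoprime m n) (hm : (m : R) ∈ I) (hn : (n : R) ∈ I) : I = ⊤ := by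
  obtain ⟨u, v, huv⟩ := h
  rw [Ideal.eq_top_iff_one]
  have := I.add_mem (I.mul_mem_left (u : R) hm) (I.mul_mem_left (v : R) hn)
  have h1 : ((u * m + v * n : ℤ) : R) = 1 := by rw [huv]; simp
  push_cast at h1
  rwa [h1] at this

/-- The ideal `(p, √-d - t)`. -/
noncomputable def splitIdeal (d p : ℕ) (t : ℤ) : Ideal (𝓞 (Kneg d)) :=
  Ideal.span {(p : 𝓞 (Kneg d)), sqrtNeg d - t}

theorem natCast_mem_splitIdeal (d p : ℕ) (t : ℤ) : (p : 𝓞 (Kneg d)) ∈ splitIdeal d p t :=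
  Ideal.subset_span (by simp)

theorem sub_mem_splitIdeal (d p : ℕ) (t : ℤ) : sqrtNeg d - t ∈ splitIdeal d p t :=
  Ideal.subset_span (by simp)

theorem isCoprime_two_mul_of_dvd {d p : ℕ} {t : ℤ} (hp : p.Prime) (hp2 : p ≠ 2) (hpd : ¬ p ∣ d)
    (ht : (p : ℤ) ∣ t ^ 2 + d) : IsCoprime (p : ℤ) (2 * t) := by
  have hpz : Prime (p : ℤ) := Nat.prime_iff_prime_int.mp hp
  rw [hpz.coprime_iff_not_dvd]
  intro h
  rcases hpz.dvd_or_dvd h with h | h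
  · have h' : p ∣ 2 := by exact_mod_cast h
    exact hp2 ((Nat.prime_dvd_prime_iff_eq hp Nat.prime_two).mp h')
  · have h2 : (p : ℤ) ∣ t ^ 2 := dvd_pow h (by norm_num)
    have h3 : (p : ℤ) ∣ d := (dvd_add_right h2).mp ht
    exact hpd (by exact_mod_cast h3)

theorem splitIdeal_mul_splitIdeal_neg {d p : ℕ} {t : ℤ} (hp : p.Prime) (hp2 : p ≠ 2)
    (hpd : ¬ p ∣ d) (ht : (p : ℤ) ∣ t ^ 2 + d) :
    splitIdeal d p t * splitIdeal d p (-t) = Ideal.span {(p : 𝓞 (Kneg d))} := by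
  apply le_antisymm
  · rw [splitIdeal, splitIdeal, Ideal.span_pair_mul_span_pair, Ideal.span_le]
    obtain ⟨c, hc⟩ := ht
    have hc' : ((t : 𝓞 (Kneg d)) ^ 2 + d) = p * c := by exact_mod_cast congrArg (Int.cast) hc
    rintro x (rfl | rfl | rfl | rfl)
    · exact Ideal.mem_span_singleton.mpr (dvd_mul_right _ _)
    · exact Ideal.mem_span_singleton.mpr (dvd_mul_right _ _)
    · exact Ideal.mem_span_singleton.mpr (dvd_mul_left _ _)
    · refine Ideal.mem_span_singleton.mpr ⟨-c, ?_⟩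
      push_cast
      linear_combination sqrtNeg_sq d - hc'
  · rw [Ideal.span_singleton_le_iff_mem]
    obtain ⟨u, v, huv⟩ := isCoprime_two_mul_of_dvd hp hp2 hpd ht
    have hP := natCast_mem_splitIdeal d p t
    have hP' := natCast_mem_splitIdeal d p (-t)
    have h1 := Ideal.mul_mem_mul hP hP'
    have h2 := Ideal.mul_mem_mul hP (sub_mem_splitIdeal d p (-t))
    have h3 := Ideal.mul_mem_mul (sub_mem_splitIdeal d p t) hP'
    have h4 := Ideal.add_mem _ (Ideal.mul_mem_left _ (u : 𝓞 (Kneg d)) h1)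
      (Ideal.mul_mem_left _ (v : 𝓞 (Kneg d)) (Ideal.sub_mem _ h2 h3))
    have huv' : (u : 𝓞 (Kneg d)) * p + v * (2 * t) = 1 := by
      exact_mod_cast congrArg (Int.cast) huv
    refine (congrArg (· ∈ _) ?_).mp h4
    push_cast
    linear_combination (p : 𝓞 (Kneg d)) * huv'

theorem splitIdeal_neg_ne_span {d p : ℕ} (hd : Squarefree d) {t : ℤ} (hp : p.Prime) (hp2 : p ≠ 2) :
    splitIdeal d p t ≠ Ideal.span {(p : 𝓞 (Kneg d))} := by
  intro h
  have h1 := sub_mem_splitIdeal d p t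
  rw [h, Ideal.mem_span_singleton] at h1
  obtain ⟨β, hβ⟩ := h1
  obtain ⟨a, b, hab⟩ := exists_two_mul_eq hd β
  have h2 : ((-2 * t : ℤ) : 𝓞 (Kneg d)) + (2 : ℤ) * sqrtNeg d
      = ((p * a : ℤ) : 𝓞 (Kneg d)) + (p * b : ℤ) * sqrtNeg d := by
    push_cast
    linear_combination 2 * hβ + p * hab
  have h3 := (int_add_mul_sqrtNeg_injective (Nat.pos_of_ne_zero hd.ne_zero) h2).2
  have h4 : p ∣ 2 := by
    have : (p : ℤ) ∣ 2 := ⟨b, h3⟩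
    exact_mod_cast this
  exact hp2 ((Nat.prime_dvd_prime_iff_eq hp Nat.prime_two).mp h4)

theorem absNorm_span_natCast {d : ℕ} (hd : 0 < d) (n : ℕ) :
    Ideal.absNorm (Ideal.span {(n : 𝓞 (Kneg d))}) = n ^ 2 := by
  rw [Ideal.absNorm_span_singleton]
  have := four_mul_norm hd (α := (n : 𝓞 (Kneg d))) (a := 2 * n) (b := 0) (by push_cast; ring)
  have h2 : Algebra.norm ℤ (n : 𝓞 (Kneg d)) = ((n ^ 2 : ℕ) : ℤ) := by
    push_cast; linarith
  rw [h2, Int.natAbs_natCast]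

theorem absNorm_splitIdeal {d p : ℕ} (hd : Squarefree d) {t : ℤ} (hp : p.Prime) (hp2 : p ≠ 2)
    (hpd : ¬ p ∣ d) (ht : (p : ℤ) ∣ t ^ 2 + d) : Ideal.absNorm (splitIdeal d p t) = p := by
  have h1 := congrArg Ideal.absNorm (splitIdeal_mul_splitIdeal_neg hp hp2 hpd ht)
  rw [map_mul, absNorm_span_natCast (Nat.pos_of_ne_zero hd.ne_zero)] at h1
  have h2 := splitIdeal_mul_splitIdeal_neg hp hp2 hpd ht
  refine ((Nat.Prime.mul_eq_prime_sq_iff hp ?_ ?_).mp h1).1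
  · intro h
    rw [Ideal.absNorm_eq_one_iff] at h
    rw [h, Ideal.top_mul] at h2
    exact splitIdeal_neg_ne_span hd hp hp2 h2
  · intro h
    rw [Ideal.absNorm_eq_one_iff] at h
    rw [h, Ideal.mul_top] at h2
    exact splitIdeal_neg_ne_span hd hp hp2 h2

theorem isPrime_splitIdeal {d p : ℕ} (hd : Squarefree d) {t : ℤ} (hp : p.Prime) (hp2 : p ≠ 2)
    (hpd : ¬ p ∣ d) (ht : (p : ℤ) ∣ t ^ 2 + d) : (splitIdeal d p t).IsPrime := by
  apply Ideal.isPrime_of_irreducible_absNorm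
  rw [absNorm_splitIdeal hd hp hp2 hpd ht]
  exact hp

theorem splitIdeal_ne_bot {d p : ℕ} {t : ℤ} (hp : p.Prime) : splitIdeal d p t ≠ ⊥ := by
  intro h
  have := natCast_mem_splitIdeal d p t
  rw [h, Ideal.mem_bot] at this
  exact hp.ne_zero (by exact_mod_cast this)

/-- `4 (pq)^g` is represented by `a² + d b²` with `gcd(a, b)` prime to `pq`. -/
def PrimitiveSolution (g d p q : ℕ) : Prop :=
  ∃ a b : ℕ, 4 * (p * q) ^ g = a ^ 2 + d * b ^ 2 ∧ ¬ (p ∣ a ∧ p ∣ b) ∧ ¬ (q ∣ a ∧ q ∣ b)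

theorem mem_of_dvd_of_two_mul_eq {d p : ℕ} {t : ℤ} (hp : p.Prime) (hp2 : p ≠ 2)
    (hP : (splitIdeal d p t).IsPrime) {α : 𝓞 (Kneg d)} {a b : ℤ}
    (h : 2 * α = a + b * sqrtNeg d) (ha : (p : ℤ) ∣ a) (hb : (p : ℤ) ∣ b) :
    α ∈ splitIdeal d p t := by
  obtain ⟨a', rfl⟩ := ha
  obtain ⟨b', rfl⟩ := hb
  have h1 : 2 * α ∈ splitIdeal d p t := by
    have := Ideal.mul_mem_right ((a' : 𝓞 (Kneg d)) + b' * sqrtNeg d) _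
      (natCast_mem_splitIdeal d p t)
    rw [h]
    refine (congrArg (· ∈ _) ?_).mp this
    push_cast; ring
  refine (hP.mem_or_mem h1).resolve_left fun h2 => hP.ne_top ?_
  refine Ideal.eq_top_of_isCoprime_intCast (m := p) (n := 2) ?_
    (by exact_mod_cast natCast_mem_splitIdeal d p t) (by exact_mod_cast h2)
  have : Nat.Coprime p 2 := (Nat.coprime_primes hp Nat.prime_two).mpr hp2
  exact_mod_cast Nat.isCoprime_iff_coprime.mpr this

theorem not_splitIdeal_neg_le {d p : ℕ} {t : ℤ} (hp : p.Prime) (hp2 : p ≠ 2) (hpd : ¬ p ∣ d)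
    (ht : (p : ℤ) ∣ t ^ 2 + d) (hP : (splitIdeal d p t).IsPrime) :
    ¬ splitIdeal d p (-t) ≤ splitIdeal d p t := by
  intro h
  apply hP.ne_top
  refine Ideal.eq_top_of_isCoprime_intCast (isCoprime_two_mul_of_dvd hp hp2 hpd ht)
    (by exact_mod_cast natCast_mem_splitIdeal d p t) ?_
  have := Ideal.sub_mem _ (h (sub_mem_splitIdeal d p (-t))) (sub_mem_splitIdeal d p t)
  refine (congrArg (· ∈ _) ?_).mp this
  push_cast; ring

theorem not_splitIdeal_le_of_ne {d p q : ℕ} {t u : ℤ} (hp : p.Prime) (hq : q.Prime) (hpq : p ≠ q)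
    (hP : (splitIdeal d p t).IsPrime) : ¬ splitIdeal d q u ≤ splitIdeal d p t := by
  intro h
  apply hP.ne_top
  exact Ideal.eq_top_of_isCoprime_intCast (m := p) (n := q)
    (Nat.isCoprime_iff_coprime.mpr ((Nat.coprime_primes hp hq).mpr hpq))
    (by exact_mod_cast natCast_mem_splitIdeal d p t)
    (by exact_mod_cast h (natCast_mem_splitIdeal d q u))

open nonZeroDivisors in
theorem primitiveSolution_of_mk0_pow_eq {g d p q : ℕ} (hd : Squarefree d) {t u : ℤ}
    (hp : p.Prime) (hp2 : p ≠ 2) (hpd : ¬ p ∣ d) (ht : (p : ℤ) ∣ t ^ 2 + d)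
    (hq : q.Prime) (hq2 : q ≠ 2) (hqd : ¬ q ∣ d) (hu : (q : ℤ) ∣ u ^ 2 + d) (hpq : p ≠ q)
    (h : ClassGroup.mk0 ⟨splitIdeal d p t, mem_nonZeroDivisors_of_ne_zero (splitIdeal_ne_bot hp)⟩ ^ g =
      ClassGroup.mk0 ⟨splitIdeal d q u, mem_nonZeroDivisors_of_ne_zero (splitIdeal_ne_bot hq)⟩ ^ g) :
    PrimitiveSolution g d p q := by
  have hd0 : 0 < d := Nat.pos_of_ne_zero hd.ne_zero
  have ht' : (p : ℤ) ∣ (-t) ^ 2 + d := by rwa [neg_sq]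
  have hu' : (q : ℤ) ∣ (-u) ^ 2 + d := by rwa [neg_sq]
  set P : (Ideal (𝓞 (Kneg d)))⁰ :=
    ⟨splitIdeal d p t, mem_nonZeroDivisors_of_ne_zero (splitIdeal_ne_bot hp)⟩ with hPdef
  set Q : (Ideal (𝓞 (Kneg d)))⁰ :=
    ⟨splitIdeal d q u, mem_nonZeroDivisors_of_ne_zero (splitIdeal_ne_bot hq)⟩ with hQdef
  set Q' : (Ideal (𝓞 (Kneg d)))⁰ :=
    ⟨splitIdeal d q (-u), mem_nonZeroDivisors_of_ne_zero (splitIdeal_ne_bot hq)⟩ with hQ'def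
  have hQQ : ClassGroup.mk0 Q * ClassGroup.mk0 Q' = 1 := by
    rw [← map_mul, ClassGroup.mk0_eq_one_iff]
    refine ⟨(q : 𝓞 (Kneg d)), ?_⟩
    exact splitIdeal_mul_splitIdeal_neg hq hq2 hqd hu
  have h1 : ClassGroup.mk0 (P ^ g * Q' ^ g) = 1 := by
    rw [map_mul, map_pow, map_pow, h, ← mul_pow, hQQ, one_pow]
  rw [ClassGroup.mk0_eq_one_iff] at h1
  obtain ⟨α, hα⟩ := h1
  have hα : splitIdeal d p t ^ g * splitIdeal d q (-u) ^ g = Ideal.span {α} := hα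
  obtain ⟨a, b, hab⟩ := exists_two_mul_eq hd α
  have hmem : ∀ J : Ideal (𝓞 (Kneg d)), J.IsPrime → α ∈ J →
      splitIdeal d p t ≤ J ∨ splitIdeal d q (-u) ≤ J := by
    intro J hJ hαJ
    have h2 : splitIdeal d p t ^ g * splitIdeal d q (-u) ^ g ≤ J := by
      rw [hα, Ideal.span_singleton_le_iff_mem]; exact hαJ
    rcases hJ.mul_le.mp h2 with h3 | h3
    · exact Or.inl (hJ.le_of_pow_le h3)
    · exact Or.inr (hJ.le_of_pow_le h3)
  have hN := congrArg Ideal.absNorm hα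
  rw [map_mul, map_pow, map_pow, absNorm_splitIdeal hd hp hp2 hpd ht,
    absNorm_splitIdeal hd hq hq2 hqd hu', Ideal.absNorm_span_singleton, ← mul_pow] at hN
  have h4 := four_mul_norm hd0 hab
  refine ⟨a.natAbs, b.natAbs, ?_, ?_, ?_⟩
  · have hpos : 0 ≤ Algebra.norm ℤ α := by nlinarith [sq_nonneg a, sq_nonneg b]
    have h5 : ((4 * (p * q) ^ g : ℕ) : ℤ) = ((a.natAbs ^ 2 + d * b.natAbs ^ 2 : ℕ) : ℤ) := by
      rw [hN]
      push_cast
      rw [sq_abs, sq_abs, abs_of_nonneg hpos, h4]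
    exact_mod_cast h5
  · rintro ⟨h5, h6⟩
    have hP' := isPrime_splitIdeal hd hp hp2 hpd ht'
    rcases hmem _ hP' (mem_of_dvd_of_two_mul_eq hp hp2 hP' hab (Int.natCast_dvd.mpr h5)
      (Int.natCast_dvd.mpr h6)) with h7 | h7
    · exact not_splitIdeal_neg_le hp hp2 hpd ht' hP' (by rwa [neg_neg])
    · exact not_splitIdeal_le_of_ne hp hq hpq hP' h7
  · rintro ⟨h5, h6⟩
    have hQ' := isPrime_splitIdeal hd hq hq2 hqd hu
    rcases hmem _ hQ' (mem_of_dvd_of_two_mul_eq hq hq2 hQ' hab (Int.natCast_dvd.mpr h5)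
      (Int.natCast_dvd.mpr h6)) with h7 | h7
    · exact not_splitIdeal_le_of_ne hq hp hpq.symm hQ' h7
    · exact not_splitIdeal_neg_le hq hq2 hqd hu hQ' h7

theorem Finset.card_sq_le_card_mul_card_pairs {ι β : Type*} [DecidableEq β] (Q : Finset ι)
    (f : ι → β) (R : Finset β) (hf : ∀ x ∈ Q, f x ∈ R) :
    Q.card ^ 2 ≤ R.card * ((Q ×ˢ Q).filter (fun z => f z.1 = f z.2)).card := by
  have h1 : Q.card = ∑ r ∈ R, (Q.filter (fun x => f x = r)).card :=
    Finset.card_eq_sum_card_fiberwise hf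
  have h2 : ((Q ×ˢ Q).filter (fun z => f z.1 = f z.2)).card
      = ∑ r ∈ R, (Q.filter (fun x => f x = r)).card ^ 2 := by
    rw [Finset.card_eq_sum_card_fiberwise (f := fun z => f z.1) (t := R)]
    · refine Finset.sum_congr rfl fun r _ => ?_
      rw [sq, ← Finset.card_product]
      congr 1
      ext ⟨x, y⟩
      simp only [Finset.mem_filter, Finset.mem_product]
      constructor
      · rintro ⟨⟨⟨hx, hy⟩, h⟩, hr⟩
        exact ⟨⟨hx, hr⟩, hy, h ▸ hr⟩
      · rintro ⟨⟨hx, hr⟩, hy, hr'⟩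
        exact ⟨⟨⟨hx, hy⟩, hr.trans hr'.symm⟩, hr⟩
    · intro z hz
      have hz := Finset.mem_filter.mp hz
      exact hf _ (Finset.mem_product.mp hz.1).1
  rw [h2, h1]
  exact sq_sum_le_card_mul_sum_sq

theorem card_torsion_mul_card_range {G : Type*} [CommGroup G] [Finite G] (g : ℕ) :
    Nat.card {c : G // c ^ g = 1} * Nat.card (powMonoidHom g : G →* G).range = Nat.card G := by
  rw [← Subgroup.index_ker, mul_comm, ← Subgroup.index_mul_card (powMonoidHom g : G →* G).ker]
  rfl

open scoped Classical in
theorem hneg_mul_card_sq_le {g d : ℕ} (hd : Squarefree d) (Q : Finset ℕ)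
    (hQ : ∀ p ∈ Q, p.Prime ∧ p ≠ 2 ∧ ¬ p ∣ d ∧ ∃ t : ℤ, (p : ℤ) ∣ t ^ 2 + d) :
    hneg g d * Q.card ^ 2 ≤ Nat.card (ClassGroup (𝓞 (Kneg d))) *
      ((Q ×ˢ Q).filter (fun z => z.1 = z.2 ∨ (z.1 ≠ z.2 ∧ PrimitiveSolution g d z.1 z.2))).card := by
  let G := ClassGroup (𝓞 (Kneg d))
  let c : ℕ → G := fun p =>
    if h : p.Prime ∧ p ≠ 2 ∧ ¬ p ∣ d ∧ ∃ t : ℤ, (p : ℤ) ∣ t ^ 2 + d then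
      ClassGroup.mk0 ⟨splitIdeal d p h.2.2.2.choose,
        mem_nonZeroDivisors_of_ne_zero (splitIdeal_ne_bot h.1)⟩
    else 1
  let R : Finset G := Finset.univ.filter (fun x => x ∈ (powMonoidHom g : G →* G).range)
  have hR : R.card = Nat.card (powMonoidHom g : G →* G).range := by
    rw [Nat.card_eq_fintype_card, Fintype.card_subtype]
  have h1 := Finset.card_sq_le_card_mul_card_pairs Q (fun p => c p ^ g) R
    (fun p _ => Finset.mem_filter.mpr ⟨Finset.mem_univ _, ⟨c p, rfl⟩⟩)
  have h2 := card_torsion_mul_card_range (G := G) g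
  have h3 : ((Q ×ˢ Q).filter (fun z => c z.1 ^ g = c z.2 ^ g)) ⊆
      ((Q ×ˢ Q).filter (fun z => z.1 = z.2 ∨ (z.1 ≠ z.2 ∧ PrimitiveSolution g d z.1 z.2))) := by
    rintro ⟨p, q⟩ hz
    simp only [Finset.mem_filter, Finset.mem_product] at hz ⊢
    refine ⟨hz.1, ?_⟩
    by_cases hpq : p = q
    · exact Or.inl hpq
    refine Or.inr ⟨hpq, ?_⟩
    have hp := hQ p hz.1.1
    have hq := hQ q hz.1.2
    have h := hz.2
    simp only [c, dif_pos hp, dif_pos hq] at h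
    exact primitiveSolution_of_mk0_pow_eq hd hp.1 hp.2.1 hp.2.2.1 hp.2.2.2.choose_spec
      hq.1 hq.2.1 hq.2.2.1 hq.2.2.2.choose_spec hpq h
  have h4 := Finset.card_le_card h3
  have h5 : hneg g d = Nat.card {c : G // c ^ g = 1} := rfl
  rw [h5]
  calc _ ≤ Nat.card {c : G // c ^ g = 1} * (R.card * _) := Nat.mul_le_mul_left _ h1
    _ = Nat.card G * _ := by rw [← mul_assoc, hR, h2]
    _ ≤ _ := Nat.mul_le_mul_left _ h4

theorem exists_mem_norm_le {d : ℕ} (hd : 0 < d) (J : Ideal (𝓞 (Kneg d))) (hJ : J ≠ ⊥) :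
    ∃ α ∈ J, α ≠ 0 ∧ ((Algebra.norm ℤ α).natAbs : ℝ) ≤ 2 * Real.sqrt d * Ideal.absNorm J := by
  classical
  set N := Ideal.absNorm J with hN
  have hN0 : N ≠ 0 := fun h => hJ (Ideal.absNorm_eq_zero_iff.mp h)
  have hNpos : (0 : ℝ) < N := by exact_mod_cast Nat.pos_of_ne_zero hN0
  have hs : 0 < Real.sqrt d := Real.sqrt_pos.mpr (by exact_mod_cast hd)
  have hss : Real.sqrt d * Real.sqrt d = d := Real.mul_self_sqrt (Nat.cast_nonneg d)
  set A := ⌊Real.sqrt (N * Real.sqrt d)⌋₊ with hA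
  set B := ⌊Real.sqrt (N / Real.sqrt d)⌋₊ with hB
  have hprod : Real.sqrt (N * Real.sqrt d) * Real.sqrt (N / Real.sqrt d) = N := by
    rw [← Real.sqrt_mul (by positivity)]
    have : N * Real.sqrt d * (N / Real.sqrt d) = (N : ℝ) * N := by field_simp
    rw [this, Real.sqrt_mul_self hNpos.le]
  have hcard : N < (A + 1) * (B + 1) := by
    have h1 : Real.sqrt (N * Real.sqrt d) < A + 1 := Nat.lt_floor_add_one _
    have h2 : Real.sqrt (N / Real.sqrt d) < B + 1 := Nat.lt_floor_add_one _
    have h3 : (N : ℝ) < (A + 1) * (B + 1) := by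
      rw [← hprod]
      exact mul_lt_mul'' h1 h2 (Real.sqrt_nonneg _) (Real.sqrt_nonneg _)
    exact_mod_cast h3
  have hcq : Nat.card (𝓞 (Kneg d) ⧸ J) = N := rfl
  have : Finite (𝓞 (Kneg d) ⧸ J) := Nat.finite_of_card_ne_zero (by rw [hcq]; exact hN0)
  have := Fintype.ofFinite (𝓞 (Kneg d) ⧸ J)
  rw [Nat.card_eq_fintype_card] at hcq
  obtain ⟨z, hz, z', hz', hne, heq⟩ := Finset.exists_ne_map_eq_of_card_lt_of_maps_to
    (s := Finset.range (A + 1) ×ˢ Finset.range (B + 1)) (t := (Finset.univ : Finset (𝓞 (Kneg d) ⧸ J)))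
    (f := fun z => Ideal.Quotient.mk J ((z.1 : 𝓞 (Kneg d)) + z.2 * sqrtNeg d))
    (by rw [Finset.card_univ, hcq, Finset.card_product, Finset.card_range, Finset.card_range]
        exact hcard) (fun _ _ => Finset.mem_univ _)
  rw [Finset.mem_product, Finset.mem_range, Finset.mem_range] at hz hz'
  have hmem := Ideal.Quotient.eq.mp heq
  set X : ℤ := (z.1 : ℤ) - z'.1 with hX
  set Y : ℤ := (z.2 : ℤ) - z'.2 with hY
  have hform : ((z.1 : 𝓞 (Kneg d)) + z.2 * sqrtNeg d) - ((z'.1 : 𝓞 (Kneg d)) + z'.2 * sqrtNeg d)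
      = (X : 𝓞 (Kneg d)) + Y * sqrtNeg d := by
    rw [hX, hY]; push_cast; ring
  rw [hform] at hmem
  refine ⟨_, hmem, ?_, ?_⟩
  · intro h0
    have := int_add_mul_sqrtNeg_injective hd (a := X) (b := Y) (a' := 0) (b' := 0)
      (by rw [h0]; push_cast; ring)
    apply hne
    ext <;> omega
  · have h4 := four_mul_norm hd (α := (X : 𝓞 (Kneg d)) + Y * sqrtNeg d) (a := 2 * X) (b := 2 * Y)
      (by push_cast; ring)
    have h5 : Algebra.norm ℤ ((X : 𝓞 (Kneg d)) + Y * sqrtNeg d) = X ^ 2 + d * Y ^ 2 := by linarith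
    have hXA : |(X : ℝ)| ≤ A := by
      have : |X| ≤ (A : ℤ) := by rw [abs_le]; constructor <;> omega
      exact_mod_cast this
    have hYB : |(Y : ℝ)| ≤ B := by
      have : |Y| ≤ (B : ℤ) := by rw [abs_le]; constructor <;> omega
      exact_mod_cast this
    have hX2 : (X : ℝ) ^ 2 ≤ N * Real.sqrt d := by
      have h6 : |(X : ℝ)| ≤ Real.sqrt (N * Real.sqrt d) :=
        hXA.trans (Nat.floor_le (Real.sqrt_nonneg _))
      exact (Real.sq_le (by positivity)).mpr (abs_le.mp h6)
    have hY2 : (Y : ℝ) ^ 2 ≤ N / Real.sqrt d := by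
      have h6 : |(Y : ℝ)| ≤ Real.sqrt (N / Real.sqrt d) :=
        hYB.trans (Nat.floor_le (Real.sqrt_nonneg _))
      exact (Real.sq_le (by positivity)).mpr (abs_le.mp h6)
    have h7 : ((Algebra.norm ℤ ((X : 𝓞 (Kneg d)) + Y * sqrtNeg d)).natAbs : ℝ)
        = (X : ℝ) ^ 2 + d * (Y : ℝ) ^ 2 := by
      have : ((Algebra.norm ℤ ((X : 𝓞 (Kneg d)) + Y * sqrtNeg d)).natAbs : ℤ)
          = X ^ 2 + d * Y ^ 2 := by
        rw [h5, Int.natCast_natAbs, abs_of_nonneg (by positivity)]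
      calc ((Algebra.norm ℤ ((X : 𝓞 (Kneg d)) + Y * sqrtNeg d)).natAbs : ℝ)
          = (((Algebra.norm ℤ ((X : 𝓞 (Kneg d)) + Y * sqrtNeg d)).natAbs : ℤ) : ℝ) :=
            (Int.cast_natCast _).symm
        _ = ((X ^ 2 + d * Y ^ 2 : ℤ) : ℝ) := by rw [this]
        _ = _ := by push_cast; ring
    have h8 : (d : ℝ) * (N / Real.sqrt d) = N * Real.sqrt d := by
      rw [mul_div_assoc', div_eq_iff hs.ne']
      linear_combination (-(N : ℝ)) * hss
    rw [h7]
    calc (X : ℝ) ^ 2 + d * (Y : ℝ) ^ 2 ≤ N * Real.sqrt d + d * (N / Real.sqrt d) := by gcongr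
      _ = 2 * Real.sqrt d * N := by
        rw [h8]; ring

theorem even_of_two_mul_eq_intCast {d : ℕ} (hd : 0 < d) {β : 𝓞 (Kneg d)} {m : ℤ}
    (h : 2 * β = m) : ∃ x : ℤ, β = x := by
  have h1 := four_mul_norm hd (α := β) (a := m) (b := 0) (by rw [h]; push_cast; ring)
  have h2 : Even (m ^ 2) := ⟨2 * Algebra.norm ℤ β, by linarith⟩
  obtain ⟨x, hx⟩ := (Int.even_pow.mp h2).1
  refine ⟨x, ?_⟩
  have h3 : (2 : 𝓞 (Kneg d)) * β = 2 * x := by rw [h, hx]; push_cast; ring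
  exact mul_left_cancel₀ two_ne_zero h3

/-- An integer generator `ω = (a + b√-d)/2` of the ring of integers. -/
theorem exists_generator {d : ℕ} (hd : Squarefree d) :
    ∃ (ω : 𝓞 (Kneg d)) (a b : ℤ), 2 * ω = a + b * sqrtNeg d ∧ b ≠ 0 ∧ b ∣ 2 ∧
      ∀ α : 𝓞 (Kneg d), ∃ x y : ℤ, α = x + y * ω := by
  have hd0 : 0 < d := Nat.pos_of_ne_zero hd.ne_zero
  by_cases h : ∃ (α : 𝓞 (Kneg d)) (a b : ℤ), 2 * α = a + b * sqrtNeg d ∧ Odd b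
  · obtain ⟨α, a, b, h1, k, rfl⟩ := h
    refine ⟨α - k * sqrtNeg d, a, 1, ?_, one_ne_zero, one_dvd _, ?_⟩
    · push_cast at h1 ⊢
      linear_combination h1
    · intro β
      obtain ⟨a', b', h2⟩ := exists_two_mul_eq hd β
      obtain ⟨x, hx⟩ := even_of_two_mul_eq_intCast hd0 (β := β - b' * (α - k * sqrtNeg d))
        (m := a' - b' * a) (by
          push_cast at h1 ⊢
          linear_combination h2 - b' * h1)
      exact ⟨x, b', by rw [← hx]; ring⟩
  · refine ⟨sqrtNeg d, 0, 2, by push_cast; ring, two_ne_zero, dvd_rfl, ?_⟩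
    intro β
    obtain ⟨a', b', h2⟩ := exists_two_mul_eq hd β
    have hb : Even b' := by
      rw [← Int.not_odd_iff_even]
      exact fun hb => h ⟨β, a', b', h2, hb⟩
    obtain ⟨k, rfl⟩ := hb
    obtain ⟨x, hx⟩ := even_of_two_mul_eq_intCast hd0 (β := β - k * sqrtNeg d) (m := a') (by
      push_cast at h2
      linear_combination h2)
    exact ⟨x, k, by rw [← hx]; ring⟩

theorem absNorm_dvd_of_intCast_mem {R : Type*} [CommRing R] [IsDedekindDomain R]
    [Module.Free ℤ R] {ω : R}
    (hω : ∀ α : R, ∃ x y : ℤ, α = x + y * ω) {I : Ideal R}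
    (hI : Ideal.absNorm I ≠ 0) {t : ℤ} (ht : ω - t ∈ I) {m : ℤ} (hm : (m : R) ∈ I) :
    (Ideal.absNorm I : ℤ) ∣ m := by
  set n := Ideal.absNorm I with hn
  have hcq : Nat.card (R ⧸ I) = n := rfl
  have : Finite (R ⧸ I) := Nat.finite_of_card_ne_zero (by rw [hcq]; exact hI)
  have hnpos : (0 : ℤ) < n := by exact_mod_cast Nat.pos_of_ne_zero hI
  have hnI : (n : R) ∈ I := Ideal.absNorm_mem I
  have hr : ((m % n : ℤ) : R) ∈ I := by
    rw [Int.emod_def]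
    push_cast
    exact I.sub_mem hm (I.mul_mem_right _ hnI)
  have hr0 : 0 ≤ m % n := Int.emod_nonneg _ hnpos.ne'
  have hrn : m % n < n := Int.emod_lt_of_pos _ hnpos
  rw [Int.dvd_iff_emod_eq_zero]
  by_contra hne
  have hrpos : 0 < m % n := lt_of_le_of_ne hr0 (Ne.symm hne)
  set r := m % n
  have hsurj : Function.Surjective
      (fun i : Fin r.toNat => Ideal.Quotient.mk I ((i : ℕ) : R)) := by
    intro z
    obtain ⟨α, rfl⟩ := Ideal.Quotient.mk_surjective z
    obtain ⟨x, y, rfl⟩ := hω α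
    have h1 : 0 ≤ (x + y * t) % r := Int.emod_nonneg _ hrpos.ne'
    have h2 : (x + y * t) % r < r := Int.emod_lt_of_pos _ hrpos
    refine ⟨⟨((x + y * t) % r).toNat, by omega⟩, ?_⟩
    rw [Ideal.Quotient.eq]
    have h3 : ((((x + y * t) % r).toNat : ℕ) : R) = (((x + y * t) % r : ℤ) : R) := by
      have : ((((x + y * t) % r).toNat : ℕ) : ℤ) = (x + y * t) % r := Int.toNat_of_nonneg h1
      exact_mod_cast congrArg (Int.cast (R := R)) this
    simp only [h3]
    rw [Int.emod_def]
    have h4 := I.sub_mem (I.neg_mem (I.mul_mem_left (y : R) ht))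
      (I.mul_mem_left (((x + y * t) / r : ℤ) : R) hr)
    refine (congrArg (· ∈ _) ?_).mp h4
    push_cast; ring
  have := Nat.card_le_card_of_surjective _ hsurj
  rw [hcq, Nat.card_eq_fintype_card, Fintype.card_fin] at this
  omega

theorem ideal_eq_of_sub_mem {R : Type*} [CommRing R] [IsDedekindDomain R]
    [Module.Free ℤ R] {ω : R}
    (hω : ∀ α : R, ∃ x y : ℤ, α = x + y * ω) {I J : Ideal R}
    (hI : Ideal.absNorm I ≠ 0) (hIJ : Ideal.absNorm I = Ideal.absNorm J) {t : ℤ}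
    (htI : ω - t ∈ I) (htJ : ω - t ∈ J) : I = J := by
  have key : ∀ I J : Ideal R, Ideal.absNorm I ≠ 0 → Ideal.absNorm I = Ideal.absNorm J →
      ω - t ∈ I → ω - t ∈ J → I ≤ J := by
    intro I J hI hIJ htI htJ α hα
    obtain ⟨x, y, rfl⟩ := hω α
    have h1 : ((x + y * t : ℤ) : R) ∈ I := by
      have := I.sub_mem hα (I.mul_mem_left (y : R) htI)
      refine (congrArg (· ∈ _) ?_).mp this
      push_cast; ring
    obtain ⟨c, hc⟩ := absNorm_dvd_of_intCast_mem hω hI htI h1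
    have h2 : ((x + y * t : ℤ) : R) ∈ J := by
      rw [hc, hIJ]
      push_cast
      exact J.mul_mem_right _ (Ideal.absNorm_mem J)
    have h3 := J.add_mem h2 (J.mul_mem_left (y : R) htJ)
    refine (congrArg (· ∈ _) ?_).mp h3
    push_cast; ring
  exact le_antisymm (key I J hI hIJ htI htJ) (key J I (hIJ ▸ hI) hIJ.symm htJ htI)

open nonZeroDivisors in
theorem exists_primitive_ideal {d : ℕ} (hd : 0 < d) {ω : 𝓞 (Kneg d)}
    (hω : ∀ α : 𝓞 (Kneg d), ∃ x y : ℤ, α = x + y * ω) (c : ClassGroup (𝓞 (Kneg d))) :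
    ∃ I : (Ideal (𝓞 (Kneg d)))⁰, ClassGroup.mk0 I = c ∧
      (Ideal.absNorm (I : Ideal (𝓞 (Kneg d))) : ℝ) ≤ 2 * Real.sqrt d ∧
      ∃ t : ℤ, 0 ≤ t ∧ t < Ideal.absNorm (I : Ideal (𝓞 (Kneg d))) ∧
        ω - t ∈ (I : Ideal (𝓞 (Kneg d))) := by
  classical
  have hpos : ∀ I : (Ideal (𝓞 (Kneg d)))⁰, Ideal.absNorm (I : Ideal (𝓞 (Kneg d))) ≠ 0 := by
    intro I h
    exact nonZeroDivisors.ne_zero I.2 (Ideal.absNorm_eq_zero_iff.mp h)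
  have hex : ∃ n : ℕ, ∃ I : (Ideal (𝓞 (Kneg d)))⁰, ClassGroup.mk0 I = c ∧
      Ideal.absNorm (I : Ideal (𝓞 (Kneg d))) = n := by
    obtain ⟨I, hI⟩ := ClassGroup.mk0_surjective c
    exact ⟨_, I, hI, rfl⟩
  obtain ⟨I, hIc, hIn⟩ := Nat.find_spec hex
  have hmin : ∀ J : (Ideal (𝓞 (Kneg d)))⁰, ClassGroup.mk0 J = c →
      Ideal.absNorm (I : Ideal (𝓞 (Kneg d))) ≤ Ideal.absNorm (J : Ideal (𝓞 (Kneg d))) := by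
    intro J hJ
    rw [hIn]
    exact Nat.find_min' hex ⟨J, hJ, rfl⟩
  refine ⟨I, hIc, ?_, ?_⟩
  · obtain ⟨J, hJ⟩ := ClassGroup.mk0_surjective c⁻¹
    have hJ0 : (J : Ideal (𝓞 (Kneg d))) ≠ ⊥ := nonZeroDivisors.ne_zero J.2
    obtain ⟨α, hαJ, hα0, hαN⟩ := exists_mem_norm_le hd (J : Ideal (𝓞 (Kneg d))) hJ0
    have hdvd : (J : Ideal (𝓞 (Kneg d))) ∣ Ideal.span {α} := by
      rw [Ideal.dvd_iff_le, Ideal.span_singleton_le_iff_mem]; exact hαJ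
    obtain ⟨I', hI'⟩ := hdvd
    have hI'0 : I' ≠ ⊥ := by
      rintro rfl
      rw [Ideal.mul_bot, Ideal.span_singleton_eq_bot] at hI'
      exact hα0 hI'
    have hcl : ClassGroup.mk0 ⟨I', mem_nonZeroDivisors_of_ne_zero hI'0⟩ = c := by
      have : ClassGroup.mk0 (J * ⟨I', mem_nonZeroDivisors_of_ne_zero hI'0⟩) = 1 := by
        rw [ClassGroup.mk0_eq_one_iff]
        exact ⟨α, hI'.symm⟩
      rw [map_mul, hJ] at this
      exact (inv_mul_eq_one.mp this).symm
    have h1 := hmin _ hcl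
    have h2 := congrArg Ideal.absNorm hI'
    rw [Ideal.absNorm_span_singleton, map_mul] at h2
    rw [h2] at hαN
    push_cast at hαN
    have hJpos : (0 : ℝ) < Ideal.absNorm (J : Ideal (𝓞 (Kneg d))) := by
      exact_mod_cast Nat.pos_of_ne_zero (hpos J)
    have h3 : (Ideal.absNorm I' : ℝ) ≤ 2 * Real.sqrt d := by
      rw [mul_comm] at hαN
      exact le_of_mul_le_mul_right hαN hJpos
    have h1' : (Ideal.absNorm (I : Ideal (𝓞 (Kneg d))) : ℝ) ≤ Ideal.absNorm I' := by
      exact_mod_cast h1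
    exact h1'.trans h3
  · set n := Ideal.absNorm (I : Ideal (𝓞 (Kneg d))) with hn
    have hn0 : n ≠ 0 := hpos I
    have hnI : (n : 𝓞 (Kneg d)) ∈ (I : Ideal (𝓞 (Kneg d))) := Ideal.absNorm_mem _
    let Y : Ideal ℤ :=
      { carrier := {y | ∃ x : ℤ, (x : 𝓞 (Kneg d)) + y * ω ∈ (I : Ideal (𝓞 (Kneg d)))}
        zero_mem' := ⟨0, by simp⟩
        add_mem' := by
          rintro y y' ⟨x, hx⟩ ⟨x', hx'⟩
          refine ⟨x + x', ?_⟩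
          refine (congrArg (· ∈ _) ?_).mp (Ideal.add_mem _ hx hx')
          push_cast; ring
        smul_mem' := by
          rintro z y ⟨x, hx⟩
          refine ⟨z * x, ?_⟩
          refine (congrArg (· ∈ _) ?_).mp (Ideal.mul_mem_left _ (z : 𝓞 (Kneg d)) hx)
          rw [smul_eq_mul]
          push_cast; ring }
    obtain ⟨k, hk⟩ := (IsPrincipalIdealRing.principal Y).principal
    have hmemY : ∀ y : ℤ, k ∣ y ↔ ∃ x : ℤ, (x : 𝓞 (Kneg d)) + y * ω ∈ (I : Ideal (𝓞 (Kneg d))) := by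
      intro y
      have h1 : y ∈ Y ↔ k ∣ y := by rw [hk]; exact Ideal.mem_span_singleton
      exact h1.symm
    have hle : (I : Ideal (𝓞 (Kneg d))) ≤ Ideal.span {(k : 𝓞 (Kneg d))} := by
      intro α hα
      obtain ⟨x, y, rfl⟩ := hω α
      have hky : k ∣ y := (hmemY y).mpr ⟨x, hα⟩
      obtain ⟨u, v, huv⟩ := hω (ω ^ 2)
      have hkx : k ∣ x + y * v := by
        refine (hmemY _).mpr ⟨y * u, ?_⟩
        refine (congrArg (· ∈ _) ?_).mp (Ideal.mul_mem_left _ ω hα)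
        push_cast
        linear_combination (y : 𝓞 (Kneg d)) * huv
      have hkx' : k ∣ x := (dvd_add_left (hky.mul_right v)).mp hkx
      obtain ⟨x', rfl⟩ := hkx'
      obtain ⟨y', rfl⟩ := hky
      rw [Ideal.mem_span_singleton]
      exact ⟨x' + y' * ω, by push_cast; ring⟩
    obtain ⟨I', hI'⟩ := Ideal.dvd_iff_le.mpr hle
    have hI'0 : I' ≠ ⊥ := by
      rintro rfl
      rw [Ideal.mul_bot] at hI'
      exact nonZeroDivisors.ne_zero I.2 hI'
    have hk0 : (k : 𝓞 (Kneg d)) ≠ 0 := by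
      intro h
      rw [h, Ideal.span_singleton_eq_bot.mpr rfl, Ideal.bot_mul] at hI'
      exact nonZeroDivisors.ne_zero I.2 hI'
    have hcl : ClassGroup.mk0 ⟨I', mem_nonZeroDivisors_of_ne_zero hI'0⟩ = c := by
      rw [← hIc, ClassGroup.mk0_eq_mk0_iff]
      exact ⟨k, 1, hk0, one_ne_zero, by simp [hI']⟩
    have h1 := hmin _ hcl
    have h2 : n = Ideal.absNorm (Ideal.span {(k : 𝓞 (Kneg d))}) * Ideal.absNorm I' := by
      rw [hn, hI', map_mul]
    have hspan : Ideal.span {(k : 𝓞 (Kneg d))} = Ideal.span {((k.natAbs : ℕ) : 𝓞 (Kneg d))} := by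
      rw [Ideal.span_singleton_eq_span_singleton, ← Int.cast_natCast]
      exact (Int.associated_natAbs k).map (Int.castRingHom (𝓞 (Kneg d)))
    rw [hspan, absNorm_span_natCast hd] at h2
    have hk1 : k.natAbs = 1 := by
      have hk' : k.natAbs ≠ 0 := by
        intro h
        apply hk0
        rw [Int.natAbs_eq_zero.mp h]; simp
      by_contra hne
      have : 2 ≤ k.natAbs := by omega
      have h3 : Ideal.absNorm I' ≠ 0 := hpos ⟨I', mem_nonZeroDivisors_of_ne_zero hI'0⟩
      have h1 : n ≤ Ideal.absNorm I' := h1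
      have h4 : 4 * Ideal.absNorm I' ≤ n :=
        calc 4 * Ideal.absNorm I' ≤ k.natAbs ^ 2 * Ideal.absNorm I' :=
              Nat.mul_le_mul_right _ (by nlinarith)
          _ = n := h2.symm
      omega
    have hk1' : k ∣ 1 := Int.natAbs_dvd.mp (by rw [hk1]; simp)
    obtain ⟨x, hx⟩ := (hmemY 1).mp hk1'
    have hnz : (0 : ℤ) < n := by exact_mod_cast Nat.pos_of_ne_zero hn0
    refine ⟨(-x) % n, Int.emod_nonneg _ hnz.ne', Int.emod_lt_of_pos _ hnz, ?_⟩
    rw [Int.emod_def]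
    have h3 := Ideal.add_mem _ hx (Ideal.mul_mem_left _ ((((-x) / n : ℤ)) : 𝓞 (Kneg d)) hnI)
    refine (congrArg (· ∈ _) ?_).mp h3
    push_cast; ring

theorem le_four_of_sq_dvd {d : ℕ} (hd : Squarefree d) {b x : ℤ} (hb0 : b ≠ 0) (hb : b ∣ 2)
    {n e : ℕ} (hn : (n : ℤ) ∣ x ^ 2 - -(d * b ^ 2)) (he : (e : ℤ) ∣ 2 * x) (hen : e ^ 2 ∣ n) :
    e ≤ 4 := by
  have h1 : (e : ℤ) ^ 2 ∣ (2 * x) ^ 2 := pow_dvd_pow_of_dvd he 2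
  have h2 : (e : ℤ) ^ 2 ∣ x ^ 2 - -(d * b ^ 2) :=
    dvd_trans (by exact_mod_cast hen) hn
  have h3 : (e : ℤ) ^ 2 ∣ d * (2 * b) ^ 2 := by
    have := dvd_sub (h2.mul_left 4) h1
    exact this.imp fun u hu => by linear_combination hu
  have h4 : e ^ 2 ∣ d * (2 * b.natAbs) ^ 2 := by
    have h5 := Int.natAbs_dvd_natAbs.mpr h3
    simpa [Int.natAbs_mul, Int.natAbs_pow] using h5
  have h6 : e ∣ 2 * b.natAbs := by
    have hc0 : 0 < 2 * b.natAbs := by positivity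
    obtain ⟨f, u, v, hf, huv, rfl, hv⟩ := Nat.exists_coprime' (m := e) (n := 2 * b.natAbs)
      (Nat.gcd_pos_of_pos_right _ hc0)
    rw [hv] at h4 ⊢
    apply mul_dvd_mul_right
    have h7 : u ^ 2 ∣ d * v ^ 2 := by
      have : u ^ 2 * f ^ 2 ∣ d * v ^ 2 * f ^ 2 := by
        have e1 : (u * f) ^ 2 = u ^ 2 * f ^ 2 := by ring
        have e2 : d * (v * f) ^ 2 = d * v ^ 2 * f ^ 2 := by ring
        rwa [e1, e2] at h4
      exact Nat.dvd_of_mul_dvd_mul_right (by positivity) this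
    have h8 : u ^ 2 ∣ d := (Nat.Coprime.pow 2 2 huv).dvd_of_dvd_mul_right h7
    have : u = 1 := Nat.isUnit_iff.mp (hd u (by rwa [← sq]))
    rw [this]; exact one_dvd _
  have h7 : b.natAbs ∣ 2 := by
    have := Int.natAbs_dvd_natAbs.mpr hb
    simpa using this
  have h8 := Nat.le_of_dvd (by norm_num) h7
  have h9 := Nat.le_of_dvd (by positivity) h6
  omega

open scoped Classical in
theorem card_classGroup_le_sum {d : ℕ} (hd : Squarefree d) :
    (Nat.card (ClassGroup (𝓞 (Kneg d))) : ℝ) ≤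
      ∑ n ∈ Finset.Icc 1 ⌊2 * Real.sqrt d⌋₊, 9 * (n.divisors.card : ℝ) := by
  have hd0 : 0 < d := Nat.pos_of_ne_zero hd.ne_zero
  obtain ⟨ω, a, b, hab, hb0, hb2, hω⟩ := exists_generator hd
  choose I hIc hIn t ht0 htn htI using exists_primitive_ideal hd0 hω
  let N : ClassGroup (𝓞 (Kneg d)) → ℕ := fun c => Ideal.absNorm (I c : Ideal (𝓞 (Kneg d)))
  have hN0 : ∀ c, N c ≠ 0 := fun c h =>
    nonZeroDivisors.ne_zero (I c).2 (Ideal.absNorm_eq_zero_iff.mp h)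
  have hmaps : ∀ c ∈ (Finset.univ : Finset (ClassGroup (𝓞 (Kneg d)))),
      N c ∈ Finset.Icc 1 ⌊2 * Real.sqrt d⌋₊ := by
    intro c _
    exact Finset.mem_Icc.mpr ⟨Nat.pos_of_ne_zero (hN0 c), Nat.le_floor (hIn c)⟩
  rw [Nat.card_eq_fintype_card, ← Finset.card_univ, Finset.card_eq_sum_card_fiberwise hmaps]
  push_cast
  refine Finset.sum_le_sum fun n hn => ?_
  have hn1 : 0 < n := (Finset.mem_Icc.mp hn).1
  have hn' : (0 : ℝ) < n := by exact_mod_cast hn1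
  set F := Finset.univ.filter (fun c => N c = n) with hF
  have hFmem : ∀ c ∈ F, N c = n := fun c hc => (Finset.mem_filter.mp hc).2
  have hinj : Set.InjOn (fun c => 2 * t c - a) (F : Set (ClassGroup (𝓞 (Kneg d)))) := by
    intro c hc c' hc' h
    have hc := hFmem c hc
    have hc' := hFmem c' hc'
    have htt : t c = t c' := by
      have : 2 * t c - a = 2 * t c' - a := h
      omega
    have : (I c : Ideal (𝓞 (Kneg d))) = I c' :=
      ideal_eq_of_sub_mem hω (hN0 c) (hc.trans hc'.symm) (htI c) (htt ▸ htI c')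
    rw [← hIc c, ← hIc c', Subtype.ext this]
  rw [← Finset.card_image_of_injOn hinj]
  refine (card_sq_modEq_le hn1 (-(d * b ^ 2)) (L := 2 * n) (by positivity) 4 _ ?_ ?_ ?_).trans
    (le_of_eq ?_)
  · intro x hx
    obtain ⟨c, hc, rfl⟩ := Finset.mem_image.mp hx
    have h1 := Ideal.absNorm_dvd_norm_of_mem (htI c)
    have h2 := four_mul_norm hd0 (α := ω - t c) (a := a - 2 * t c) (b := b)
      (by push_cast; linear_combination hab)
    have hNc : Ideal.absNorm (I c : Ideal (𝓞 (Kneg d))) = n := hFmem c hc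
    rw [hNc] at h1
    have := h1.mul_left 4
    rw [h2] at this
    exact this.imp fun u hu => by linear_combination hu
  · intro x hx y hy
    obtain ⟨c, hc, rfl⟩ := Finset.mem_image.mp hx
    obtain ⟨c', hc', rfl⟩ := Finset.mem_image.mp hy
    have h1 : t c < n := by
      have := htn c
      have hNc : Ideal.absNorm (I c : Ideal (𝓞 (Kneg d))) = n := hFmem c hc
      rwa [hNc] at this
    have h2 := ht0 c'
    have h3 : (2 * t c - a) - (2 * t c' - a) ≤ 2 * (n : ℤ) := by omega
    exact_mod_cast h3
  · intro x hx e he hen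
    obtain ⟨c, hc, rfl⟩ := Finset.mem_image.mp hx
    have h1 := Ideal.absNorm_dvd_norm_of_mem (htI c)
    have h2 := four_mul_norm hd0 (α := ω - t c) (a := a - 2 * t c) (b := b)
      (by push_cast; linear_combination hab)
    have hNc : Ideal.absNorm (I c : Ideal (𝓞 (Kneg d))) = n := hFmem c hc
    rw [hNc] at h1
    have := h1.mul_left 4
    rw [h2] at this
    exact le_four_of_sq_dvd hd hb0 hb2 (this.imp fun u hu => by linear_combination hu) he hen
  · field_simp; norm_num

theorem exists_card_classGroup_le {η : ℝ} (hη : 0 < η) :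
    ∃ C : ℝ, 0 < C ∧ ∀ d : ℕ, Squarefree d →
      (Nat.card (ClassGroup (𝓞 (Kneg d))) : ℝ) ≤ C * (d : ℝ) ^ (1 / 2 + η) := by
  obtain ⟨C, hC1, hC⟩ := exists_card_divisors_le_rpow (η := 2 * η) (by positivity)
  refine ⟨2 * (9 * (C * 2 ^ (2 * η))), by positivity, fun d hd => ?_⟩
  have hd0 : (0 : ℝ) < d := by exact_mod_cast Nat.pos_of_ne_zero hd.ne_zero
  have hs : 0 < Real.sqrt d := Real.sqrt_pos.mpr hd0
  have hsr : (Real.sqrt d) ^ (2 * η) = (d : ℝ) ^ η := by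
    rw [Real.sqrt_eq_rpow, ← Real.rpow_mul hd0.le]; congr 1; ring
  calc _ ≤ ∑ n ∈ Finset.Icc 1 ⌊2 * Real.sqrt d⌋₊, 9 * (n.divisors.card : ℝ) :=
        card_classGroup_le_sum hd
    _ ≤ ∑ n ∈ Finset.Icc 1 ⌊2 * Real.sqrt d⌋₊, 9 * (C * (2 * Real.sqrt d) ^ (2 * η)) := by
        refine Finset.sum_le_sum fun n hn => ?_
        rw [Finset.mem_Icc] at hn
        have h1 := hC n hn.1
        have h2 : (n : ℝ) ≤ 2 * Real.sqrt d := (Nat.le_floor_iff (by positivity)).mp hn.2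
        calc 9 * (n.divisors.card : ℝ) ≤ 9 * (C * (n : ℝ) ^ (2 * η)) := by gcongr
          _ ≤ _ := by gcongr
    _ = ⌊2 * Real.sqrt d⌋₊ * (9 * (C * (2 * Real.sqrt d) ^ (2 * η))) := by
        rw [Finset.sum_const, Nat.card_Icc, nsmul_eq_mul]; simp
    _ ≤ (2 * Real.sqrt d) * (9 * (C * (2 * Real.sqrt d) ^ (2 * η))) := by
        gcongr
        exact Nat.floor_le (by positivity)
    _ = 2 * (9 * (C * 2 ^ (2 * η))) * (d : ℝ) ^ (1 / 2 + η) := by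
        rw [Real.mul_rpow (by norm_num) hs.le, hsr, Real.rpow_add hd0, Real.sqrt_eq_rpow]
        ring

open scoped NumberTheorySymbols in
theorem exists_jacobiSym_mul_eq_neg_one {d e : ℕ} (hd : Squarefree d) (he : Squarefree e)
    (hne : d ≠ e) : ∃ m : ℕ, Odd m ∧ J(((d * e : ℕ) : ℤ) | m) = -1 := by
  have aux : ∀ {p w : ℕ}, p.Prime → p ≠ 2 → ¬ p ∣ w →
      ∃ m : ℕ, Odd m ∧ J(((p * w : ℕ) : ℤ) | m) = -1 := by
    intro p w hp hp2 hpw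
    have : Fact p.Prime := ⟨hp⟩
    have hw : w ≠ 0 := by rintro rfl; simp at hpw
    obtain ⟨c, hc⟩ := FiniteField.exists_nonsquare (F := ZMod p) (by rwa [ZMod.ringChar_zmod_n])
    have hpodd : Odd p := hp.odd_of_ne_two hp2
    have hcop : Nat.Coprime (4 * w) p := by
      refine Nat.Coprime.symm ((hp.coprime_iff_not_dvd).mpr fun h => ?_)
      rcases hp.dvd_mul.mp h with h | h
      · rw [show 4 = 2 ^ 2 by norm_num] at h
        exact hp2 ((Nat.prime_dvd_prime_iff_eq hp Nat.prime_two).mp (hp.dvd_of_dvd_pow h))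
      · exact hpw h
    obtain ⟨m, hm1, hm2⟩ := Nat.chineseRemainder hcop 1 c.val
    have hm4 : m % 4 = 1 := by
      have := hm1.of_mul_right w
      simpa [Nat.ModEq] using this
    have hmodd : Odd m := Nat.odd_iff.mpr (by omega)
    refine ⟨m, hmodd, ?_⟩
    have h1 : J((w : ℤ) | m) = 1 := by
      rw [jacobiSym.mod_right' w hmodd, hm1, Nat.mod_eq_of_lt (by omega), jacobiSym.one_right]
    have h2 : J((p : ℤ) | m) = -1 := by
      rw [jacobiSym.quadratic_reciprocity_one_mod_four' hpodd hm4,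
        ZMod.nonsquare_iff_jacobiSym_eq_neg_one]
      have h3 : ((m : ℤ) : ZMod p) = c := by
        have := (ZMod.natCast_eq_natCast_iff m c.val p).mpr hm2
        rw [ZMod.natCast_zmod_val] at this
        exact_mod_cast this
      rwa [h3]
    push_cast
    rw [jacobiSym.mul_left, h1, h2]; norm_num
  by_cases h : ∃ p : ℕ, p.Prime ∧ p ≠ 2 ∧ ¬ (p ∣ d ↔ p ∣ e)
  · obtain ⟨p, hp, hp2, hpd⟩ := h
    have key : ∀ {d e : ℕ}, Squarefree d → p ∣ d → ¬ p ∣ e →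
        ∃ m : ℕ, Odd m ∧ J(((d * e : ℕ) : ℤ) | m) = -1 := by
      rintro _ e hd ⟨w, rfl⟩ hpe
      rw [mul_assoc]
      refine aux hp hp2 fun h => ?_
      rcases hp.dvd_mul.mp h with h | h
      · exact hp.one_lt.ne' (Nat.isUnit_iff.mp (hd p (mul_dvd_mul_left p h)))
      · exact hpe h
    by_cases h1 : p ∣ d
    · exact key hd h1 (by tauto)
    · rw [mul_comm d e]
      exact key he (by tauto) h1
  · push Not at h
    have key : ∀ {d e : ℕ}, Squarefree d → Squarefree e →
        (∀ p : ℕ, p.Prime → p ≠ 2 → (p ∣ d ↔ p ∣ e)) → 2 ∣ d → ¬ 2 ∣ e →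
        ∃ m : ℕ, Odd m ∧ J(((d * e : ℕ) : ℤ) | m) = -1 := by
      rintro _ e hd he h ⟨w, rfl⟩ h2e
      have hwe : w = e := by
        have hw : Squarefree w := hd.squarefree_of_dvd (dvd_mul_left _ _)
        refine (Nat.Squarefree.ext_iff hw he).mpr fun p hp => ?_
        by_cases hp2 : p = 2
        · subst hp2
          refine ⟨fun hw => ?_, fun he => absurd he h2e⟩
          exact absurd (Nat.isUnit_iff.mp (hd 2 (mul_dvd_mul_left 2 hw))) (by norm_num)
        · rw [← h p hp hp2, hp.dvd_mul, Nat.prime_dvd_prime_iff_eq hp Nat.prime_two]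
          tauto
      subst hwe
      have hcop : Nat.Coprime 8 w := by
        have : Nat.Coprime 2 w := (Nat.prime_two.coprime_iff_not_dvd).mpr h2e
        exact this.pow_left 3
      obtain ⟨m, hm1, hm2⟩ := Nat.chineseRemainder hcop 5 1
      have hm8 : m % 8 = 5 := hm1
      have hmodd : Odd m := Nat.odd_iff.mpr (by omega)
      refine ⟨m, hmodd, ?_⟩
      have h3 : J((2 : ℤ) | m) = -1 := by
        have h4 := jacobiSym.mod_right' 2 hmodd
        rw [show 4 * 2 = 8 by norm_num, hm8] at h4
        refine h4.trans ?_
        norm_num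
      have h5 : Int.gcd (w : ℤ) m = 1 := by
        rw [Int.gcd_natCast_natCast, Nat.gcd_comm]
        have := hm2.gcd_eq
        simpa using this
      push_cast
      rw [jacobiSym.mul_left, jacobiSym.mul_left, mul_assoc, ← sq, jacobiSym.sq_one h5, h3]
      norm_num
    by_cases h1 : 2 ∣ d
    · by_cases h2 : 2 ∣ e
      · exact absurd ((Nat.Squarefree.ext_iff hd he).mpr fun p hp => by
          by_cases hp2 : p = 2
          · subst hp2; tauto
          · exact h p hp hp2) hne
      · exact key hd he h h1 h2
    · by_cases h2 : 2 ∣ e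
      · rw [mul_comm d e]
        exact key he hd (fun p hp hp2 => (h p hp hp2).symm) h2 h1
      · exact absurd ((Nat.Squarefree.ext_iff hd he).mpr fun p hp => by
          by_cases hp2 : p = 2
          · subst hp2; tauto
          · exact h p hp hp2) hne

theorem abs_sum_range_le_of_periodic {f : ℕ → ℤ} {q : ℕ} (hq : 0 < q) (hf : f.Periodic q)
    (hf1 : ∀ n, |f n| ≤ 1) (h0 : ∑ n ∈ Finset.range q, f n = 0) (N : ℕ) :
    |∑ n ∈ Finset.range N, f n| ≤ q := by
  induction N using Nat.strong_induction_on with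
  | _ N ih =>
    by_cases hN : N < q
    · calc |∑ n ∈ Finset.range N, f n| ≤ ∑ n ∈ Finset.range N, |f n| :=
            Finset.abs_sum_le_sum_abs _ _
        _ ≤ ∑ n ∈ Finset.range N, 1 := Finset.sum_le_sum fun n _ => hf1 n
        _ ≤ q := by simp; omega
    · obtain ⟨m, rfl⟩ := Nat.exists_eq_add_of_le (not_lt.mp hN)
      rw [Finset.sum_range_add, h0, zero_add]
      simp_rw [add_comm q, hf _]
      exact ih m (by omega)

open scoped NumberTheorySymbols in
/-- Cancellation in sums of the Jacobi symbol over its lower argument. -/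
theorem abs_sum_jacobiSym_le {d e : ℕ} (hd : Squarefree d) (he : Squarefree e)
    (hne : d ≠ e) (N : ℕ) :
    |∑ n ∈ (Finset.range N).filter (fun n => Odd n), J(((d * e : ℕ) : ℤ) | n)|
      ≤ 4 * (d * e : ℕ) := by
  obtain ⟨m, hm, hJ⟩ := exists_jacobiSym_mul_eq_neg_one hd he hne
  have ha0 : 0 < d * e := Nat.mul_pos (Nat.pos_of_ne_zero hd.ne_zero) (Nat.pos_of_ne_zero he.ne_zero)
  set a := d * e with ha
  rw [Finset.sum_filter]
  have hodd : ∀ n, Odd (n % (4 * a)) ↔ Odd n := fun n => by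
    rw [Nat.odd_iff, Nat.odd_iff, Nat.mod_mod_of_dvd]
    exact ⟨2 * a, by ring⟩
  set f : ℕ → ℤ := fun n => if Odd n then J((a : ℤ) | n) else 0 with hf
  have hmod : ∀ n, f (n % (4 * a)) = f n := by
    intro n
    simp only [hf, hodd]
    split_ifs with h
    · exact (jacobiSym.mod_right' a h).symm
    · rfl
  have hper : f.Periodic (4 * a) := fun n => by
    rw [← hmod, Nat.add_mod_right, hmod]
  have hf1 : ∀ n, |f n| ≤ 1 := by
    intro n
    simp only [hf]
    split_ifs
    · rcases jacobiSym.trichotomy a n with h | h | h <;> rw [h] <;> norm_num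
    · norm_num
  have hmul : ∀ n, f (m * n) = - f n := by
    intro n
    simp only [hf, Nat.odd_mul, hm, true_and]
    split_ifs with h
    · rw [jacobiSym.mul_right' _ (by rintro rfl; simp at hm) (by rintro rfl; simp at h), hJ]; ring
    · simp
  have hzero : ∑ n ∈ Finset.range (4 * a), f n = 0 := by
    have hcop : Nat.Coprime m (4 * a) := by
      have h1 : Int.gcd (a : ℤ) m = 1 := by
        by_contra h
        have := jacobiSym.eq_zero_iff (a := a) (b := m) |>.mpr ⟨by rintro rfl; simp at hm, h⟩
        rw [hJ] at this
        norm_num at this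
      have h2 : Nat.Coprime m 4 := by
        rw [show 4 = 2 ^ 2 by norm_num]
        exact (Nat.coprime_two_right.mpr hm).pow_right 2
      exact Nat.Coprime.mul_right h2 (Nat.Coprime.symm h1)
    have : NeZero (4 * a) := ⟨by omega⟩
    have hrange : ∑ n ∈ Finset.range (4 * a), f n = ∑ x : ZMod (4 * a), f x.val := by
      refine (Finset.sum_nbij' (fun x : ZMod (4 * a) => x.val) (fun n => (n : ZMod (4 * a)))
        ?_ ?_ ?_ ?_ ?_).symm
      · intro x _; simpa using ZMod.val_lt x
      · simp
      · intro x _; simp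
      · intro n hn; exact ZMod.val_cast_of_lt (by simpa using hn)
      · simp
    have hperm : ∑ x : ZMod (4 * a), f x.val = ∑ x : ZMod (4 * a), f ((m : ZMod (4 * a)) * x).val :=
      (Equiv.sum_comp (Units.mulLeft (ZMod.unitOfCoprime m hcop)) fun x => f x.val).symm
    have hneg : ∑ x : ZMod (4 * a), f ((m : ZMod (4 * a)) * x).val
        = - ∑ x : ZMod (4 * a), f x.val := by
      rw [← Finset.sum_neg_distrib]
      refine Finset.sum_congr rfl fun x _ => ?_
      rw [ZMod.val_mul, ZMod.val_natCast, hmod, ← hmul, ← hmod (m % (4 * a) * x.val),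
        ← hmod (m * x.val)]
      simp [Nat.mul_mod]
    rw [hrange]
    linarith [hperm.trans hneg]
  have := abs_sum_range_le_of_periodic (by omega) hper hf1 hzero N
  simpa using this

theorem card_filter_prod_eq_le {W : Finset ℕ} (hp : ∀ p ∈ W, p.Prime) (k n : ℕ) :
    ((Fintype.piFinset fun _ : Fin k => W).filter (fun t => ∏ i, t i = n)).card ≤ k.factorial := by
  rcases Finset.eq_empty_or_nonempty
    ((Fintype.piFinset fun _ : Fin k => W).filter (fun t => ∏ i, t i = n)) with h | ⟨t₀, ht₀⟩
  · simp [h]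
  have hperm : ∀ t ∈ (Fintype.piFinset fun _ : Fin k => W).filter (fun t => ∏ i, t i = n),
      (List.ofFn t).Perm n.primeFactorsList := by
    intro t ht
    rw [Finset.mem_filter, Fintype.mem_piFinset] at ht
    refine Nat.primeFactorsList_unique (by rw [List.prod_ofFn]; exact ht.2) ?_
    intro p hp'
    obtain ⟨i, rfl⟩ := (List.mem_ofFn' _ _).mp hp'
    exact hp _ (ht.1 i)
  have hlen : n.primeFactorsList.length = k := by
    rw [← (hperm t₀ ht₀).length_eq, List.length_ofFn]
  calc _ ≤ (n.primeFactorsList.permutations.toFinset).card := by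
        refine Finset.card_le_card_of_injOn List.ofFn ?_ (List.ofFn_injective.injOn)
        intro t ht
        simpa using hperm t ht
    _ ≤ n.primeFactorsList.permutations.length := List.toFinset_card_le _
    _ = k.factorial := by rw [List.length_permutations, hlen]

open scoped NumberTheorySymbols in
/-- A large sieve bound for the number of `d` for which few primes of `W` split. -/
theorem card_mul_pow_le_of_sum_jacobiSym_le {D W : Finset ℕ} {Y P : ℕ}
    (hD : ∀ d ∈ D, Squarefree d ∧ d ≤ Y) (hW : ∀ p ∈ W, p.Prime ∧ p ≠ 2 ∧ p ≤ P)
    (hbad : ∀ d ∈ D, (W.card : ℤ) ≤ -2 * ∑ p ∈ W, J(-(d : ℤ) | p)) (k : ℕ) :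
    D.card * W.card ^ k ≤ 4 ^ k * k.factorial * (P ^ k + 1 + 4 * Y ^ 3) := by
  set M := W.card with hM
  set N := P ^ k + 1 with hN
  set G : ℕ → ℤ := fun n => ∑ d ∈ D, J(-(d : ℤ) | n) with hG
  set O := (Finset.range N).filter (fun n => Odd n) with hO
  have hDY : D.card ≤ Y := by
    have : D ⊆ Finset.Icc 1 Y := fun d hd => Finset.mem_Icc.mpr
      ⟨Nat.pos_of_ne_zero (hD d hd).1.ne_zero, (hD d hd).2⟩
    simpa using Finset.card_le_card this
  have hlow : (D.card : ℤ) * M ^ k ≤ 2 ^ k * ((-1) ^ k *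
      ∑ t ∈ Fintype.piFinset fun _ : Fin k => W, G (∏ i, t i)) := by
    have h1 : ∑ t ∈ Fintype.piFinset (fun _ : Fin k => W), G (∏ i, t i)
        = ∑ d ∈ D, (∑ p ∈ W, J(-(d : ℤ) | p)) ^ k := by
      rw [Finset.sum_comm]
      refine Finset.sum_congr rfl fun d _ => ?_
      have := Finset.prod_univ_sum (fun _ : Fin k => W) (fun _ p => J(-(d : ℤ) | p))
      rw [Finset.prod_const, Finset.card_univ, Fintype.card_fin] at this
      rw [this]
      refine Finset.sum_congr rfl fun t ht => ?_
      rw [Fintype.mem_piFinset] at ht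
      rw [← List.prod_ofFn, jacobiSym.list_prod_right, List.map_ofFn, List.prod_ofFn]
      · rfl
      · intro n hn
        obtain ⟨i, rfl⟩ := (List.mem_ofFn' _ _).mp hn
        exact (hW _ (ht i)).1.ne_zero
    rw [h1, Finset.mul_sum, Finset.mul_sum, ← nsmul_eq_mul]
    refine Finset.card_nsmul_le_sum _ _ _ fun d hd => ?_
    rw [← mul_pow, ← mul_pow]
    refine pow_le_pow_left₀ (by positivity) ?_ k
    linarith [hbad d hd]
  have hCS : (∑ t ∈ Fintype.piFinset (fun _ : Fin k => W), G (∏ i, t i)) ^ 2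
      ≤ M ^ k * (k.factorial * ∑ n ∈ O, G n ^ 2) := by
    have h1 := sq_sum_le_card_mul_sum_sq (s := Fintype.piFinset (fun _ : Fin k => W))
      (f := fun t => G (∏ i, t i))
    rw [Fintype.card_piFinset_const] at h1
    refine h1.trans ?_
    push_cast
    refine mul_le_mul_of_nonneg_left ?_ (by positivity)
    have hmaps : ∀ t ∈ Fintype.piFinset (fun _ : Fin k => W), ∏ i, t i ∈ O := by
      intro t ht
      rw [Fintype.mem_piFinset] at ht
      rw [hO, Finset.mem_filter, Finset.mem_range, hN, Nat.lt_succ_iff]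
      constructor
      · calc ∏ i, t i ≤ ∏ _i : Fin k, P := Finset.prod_le_prod' fun i _ => (hW _ (ht i)).2.2
          _ = P ^ k := by simp
      · refine Finset.prod_induction _ Odd (fun _ _ => Odd.mul) odd_one fun i _ => ?_
        exact (hW _ (ht i)).1.odd_of_ne_two (hW _ (ht i)).2.1
    rw [← Finset.sum_fiberwise_of_maps_to hmaps, Finset.mul_sum]
    refine Finset.sum_le_sum fun n _ => ?_
    rw [Finset.sum_congr rfl (g := fun _ => G n ^ 2)
      (fun t ht => by rw [(Finset.mem_filter.mp ht).2]), Finset.sum_const, nsmul_eq_mul]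
    refine mul_le_mul_of_nonneg_right ?_ (sq_nonneg _)
    exact_mod_cast card_filter_prod_eq_le (fun p hp => (hW p hp).1) k n
  have hGsq : ∑ n ∈ O, G n ^ 2 ≤ D.card * (N + 4 * Y ^ 3) := by
    have h1 : ∑ n ∈ O, G n ^ 2 = ∑ d ∈ D, ∑ e ∈ D, ∑ n ∈ O, J(((d * e : ℕ) : ℤ) | n) := by
      simp_rw [hG, sq, Finset.sum_mul_sum]
      rw [Finset.sum_comm]
      refine Finset.sum_congr rfl fun d _ => ?_
      rw [Finset.sum_comm]
      refine Finset.sum_congr rfl fun e _ => Finset.sum_congr rfl fun n _ => ?_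
      rw [← jacobiSym.mul_left]
      push_cast
      congr 1
      ring
    rw [h1, ← nsmul_eq_mul]
    refine Finset.sum_le_card_nsmul _ _ _ fun d hd => ?_
    rw [← Finset.add_sum_erase _ _ hd]
    refine add_le_add ?_ ?_
    · calc ∑ n ∈ O, J(((d * d : ℕ) : ℤ) | n) ≤ ∑ n ∈ O, 1 := by
            refine Finset.sum_le_sum fun n _ => ?_
            rcases jacobiSym.trichotomy ((d * d : ℕ) : ℤ) n with h | h | h <;> rw [h] <;> norm_num
        _ ≤ N := by
            rw [Finset.sum_const, nsmul_eq_mul, mul_one]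
            have := Finset.card_filter_le (Finset.range N) (fun n => Odd n)
            rw [Finset.card_range] at this
            exact_mod_cast this
    · calc ∑ e ∈ D.erase d, ∑ n ∈ O, J(((d * e : ℕ) : ℤ) | n)
          ≤ ∑ e ∈ D.erase d, (4 * Y ^ 2 : ℤ) := by
            refine Finset.sum_le_sum fun e he => ?_
            rw [Finset.mem_erase] at he
            have h2 := (le_abs_self _).trans
              (abs_sum_jacobiSym_le (hD d hd).1 (hD e he.2).1 he.1.symm N)
            refine h2.trans ?_
            have := Nat.mul_le_mul (hD d hd).2 (hD e he.2).2
            rw [← sq] at this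
            exact_mod_cast Nat.mul_le_mul_left 4 this
        _ ≤ Y * (4 * Y ^ 2) := by
            rw [Finset.sum_const, nsmul_eq_mul]
            refine mul_le_mul_of_nonneg_right ?_ (by positivity)
            exact_mod_cast (Finset.card_erase_le).trans hDY
        _ = 4 * Y ^ 3 := by ring
  rcases Nat.eq_zero_or_pos (D.card * M ^ k) with h0 | hpos
  · rw [h0]; exact Nat.zero_le _
  have hfin : ((D.card : ℤ) * M ^ k) ^ 2
      ≤ (D.card * M ^ k) * (4 ^ k * k.factorial * (N + 4 * Y ^ 3)) := by
    calc ((D.card : ℤ) * M ^ k) ^ 2 ≤ (2 ^ k * ((-1) ^ k *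
          ∑ t ∈ Fintype.piFinset fun _ : Fin k => W, G (∏ i, t i))) ^ 2 :=
          pow_le_pow_left₀ (by positivity) hlow 2
      _ = 4 ^ k * (∑ t ∈ Fintype.piFinset fun _ : Fin k => W, G (∏ i, t i)) ^ 2 := by
          rw [mul_pow, mul_pow, ← pow_mul, ← pow_mul, mul_comm k 2, pow_mul, pow_mul]
          norm_num
      _ ≤ 4 ^ k * (M ^ k * (k.factorial * (D.card * (N + 4 * Y ^ 3)))) := by
          gcongr
          exact hCS.trans (by gcongr)
      _ = _ := by ring
  rw [sq] at hfin
  have hpos' : (0 : ℤ) < D.card * M ^ k := by exact_mod_cast hpos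
  exact_mod_cast le_of_mul_le_mul_left hfin hpos'

/-- For a fixed pair of primes, few `d` in a dyadic range admit a primitive solution. -/
theorem card_primitiveSolution_le {g p q : ℕ} (hp : p.Prime) (hq : q.Prime) (hp2 : p ≠ 2)
    (hq2 : q ≠ 2) (hg : g ≠ 0) {X τ : ℝ} (hX : 0 < X) (D : Finset ℕ)
    (hD : ∀ d ∈ D, X ≤ d ∧ (d : ℝ) < 2 * X ∧ PrimitiveSolution g d p q) (hτ0 : 0 ≤ τ)
    (hτ : ∀ b : ℕ, 0 < b → (b : ℝ) ^ 2 * X ≤ 4 * (p * q : ℝ) ^ g →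
      ((b ^ 2).divisors.card : ℝ) ≤ τ) :
    (D.card : ℝ) ≤ τ * (16 * Real.sqrt X + 2 * Real.sqrt ((p * q : ℝ) ^ g) / Real.sqrt X) := by
  set n : ℕ := (p * q) ^ g with hn
  have hn0 : 0 < n := pow_pos (Nat.mul_pos hp.pos hq.pos) _
  have hnR : ((p * q : ℝ) ^ g) = (n : ℝ) := by rw [hn]; push_cast; ring
  rw [hnR] at hτ ⊢
  set s := Real.sqrt n with hs
  have hs0 : 0 < s := Real.sqrt_pos.mpr (by exact_mod_cast hn0)
  have hss : s ^ 2 = n := Real.sq_sqrt (Nat.cast_nonneg _)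
  set x := Real.sqrt X with hx
  have hx0 : 0 < x := Real.sqrt_pos.mpr hX
  have hxx : x ^ 2 = X := Real.sq_sqrt hX.le
  choose! a b hab using fun d hd => (hD d hd).2.2
  have hb0 : ∀ d ∈ D, 0 < b d := by
    intro d hd
    obtain ⟨h1, h2, -⟩ := hab d hd
    refine Nat.pos_of_ne_zero fun h => h2 ⟨?_, by rw [h]; exact dvd_zero _⟩
    rw [h] at h1
    refine hp.dvd_of_dvd_pow (n := 2) ?_
    rw [show a d ^ 2 = 4 * (p * q) ^ g by rw [h1]; ring]
    exact ((dvd_mul_right p q).trans (dvd_pow_self _ hg)).mul_left 4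
  have hmain : ∀ d ∈ D, 4 * (n : ℝ) = (a d : ℝ) ^ 2 + d * (b d : ℝ) ^ 2 := fun d hd => by
    exact_mod_cast (hab d hd).1
  have hbX : ∀ d ∈ D, (b d : ℝ) ^ 2 * X ≤ 4 * n := by
    intro d hd
    rw [hmain d hd]
    nlinarith [sq_nonneg (a d : ℝ), sq_nonneg (b d : ℝ), (hD d hd).1]
  have hbmax : ∀ d ∈ D, b d ∈ Finset.Icc 1 ⌊2 * s / x⌋₊ := by
    intro d hd
    rw [Finset.mem_Icc]
    refine ⟨hb0 d hd, Nat.le_floor ?_⟩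
    rw [le_div_iff₀ hx0]
    have h := hbX d hd
    rw [← hxx, ← hss] at h
    refine le_of_sq_le_sq ?_ (by positivity)
    nlinarith
  have hfib : ∀ c ∈ Finset.Icc 1 ⌊2 * s / x⌋₊,
      (((D.filter fun d => b d = c).card : ℕ) : ℝ) ≤ τ * (8 * X / s + 1) := by
    intro c hc
    have hc0 : 0 < c := (Finset.mem_Icc.mp hc).1
    rcases (D.filter fun d => b d = c).eq_empty_or_nonempty with h | ⟨d₀, hd₀⟩
    · rw [h, Finset.card_empty]; push_cast; positivity
    have hcX : (c : ℝ) ^ 2 * X ≤ 4 * n := by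
      rw [Finset.mem_filter] at hd₀
      rw [← hd₀.2]; exact hbX _ hd₀.1
    have hinj : Set.InjOn (fun d => (a d : ℤ)) (D.filter fun d => b d = c : Finset ℕ) := by
      intro d hd e he hde
      simp only [Finset.coe_filter, Set.mem_ofPred_eq, Nat.cast_inj] at hd he hde
      have h1 := (hab d hd.1).1
      have h2 := (hab e he.1).1
      rw [h2, hde, hd.2, he.2] at h1
      exact (Nat.eq_of_mul_eq_mul_right (pow_pos hc0 2) (Nat.add_left_cancel h1)).symm
    rw [← Finset.card_image_of_injOn hinj]
    set L := 2 * X * c ^ 2 / s with hL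
    have hcR : (0 : ℝ) < c := by exact_mod_cast hc0
    have hLs : L * s = 2 * X * c ^ 2 := by rw [hL]; field_simp
    have hL0 : 0 ≤ L := by positivity
    have key := card_sq_modEq_le (n := c ^ 2) (pow_pos hc0 2) (4 * n : ℤ) hL0 4
      ((D.filter fun d => b d = c).image fun d => (a d : ℤ)) ?_ ?_ ?_
    · refine key.trans ?_
      refine mul_le_mul (hτ c hc0 hcX) (le_of_eq ?_) (by positivity) hτ0
      rw [hL]; push_cast; field_simp; ring
    · intro z hz
      rw [Finset.mem_image] at hz
      obtain ⟨d, hd, rfl⟩ := hz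
      rw [Finset.mem_filter] at hd
      have h1 : (4 * n : ℤ) = (a d : ℤ) ^ 2 + d * (b d : ℤ) ^ 2 := by
        exact_mod_cast (hab d hd.1).1
      rw [hd.2] at h1
      exact ⟨-d, by push_cast; linear_combination -h1⟩
    · intro z hz w hw
      rw [Finset.mem_image] at hz hw
      obtain ⟨d, hd, rfl⟩ := hz
      obtain ⟨e, he, rfl⟩ := hw
      rw [Finset.mem_filter] at hd he
      have h1 := hmain d hd.1
      have h2 := hmain e he.1
      rw [hd.2] at h1
      rw [he.2] at h2
      have hd1 := hD d hd.1
      have he1 := hD e he.1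
      push_cast
      have hA : (0 : ℝ) ≤ a d := Nat.cast_nonneg _
      have hB : (0 : ℝ) ≤ a e := Nat.cast_nonneg _
      by_contra hcon
      push Not at hcon
      have hc2 : (0 : ℝ) < (c : ℝ) ^ 2 := by positivity
      have h3 : ((a d : ℝ) - a e) * (a d + a e) ≤ X * c ^ 2 := by nlinarith
      have h4 : L * (a d + a e) ≤ X * c ^ 2 := by nlinarith
      have h5 : (2 : ℝ) * (a d + a e) ≤ s := by
        have h6 : L * (2 * (a d + a e)) ≤ L * s := by rw [hLs]; linarith
        have hLpos : 0 < L := by positivity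
        exact le_of_mul_le_mul_left h6 hLpos
      have h7 : (a d : ℝ) ≤ s / 2 := by linarith
      have h8 : (a d : ℝ) ^ 2 ≤ s ^ 2 / 4 := by nlinarith
      have h9 : 15 / 4 * s ^ 2 ≤ 2 * X * c ^ 2 := by nlinarith
      have h10 : 15 / 4 * s ≤ L := by
        rw [← hLs] at h9
        nlinarith
      linarith
    · intro z hz e he hen
      rw [Finset.mem_image] at hz
      obtain ⟨d, hd, rfl⟩ := hz
      rw [Finset.mem_filter] at hd
      obtain ⟨h1, h2, h3⟩ := hab d hd.1
      rw [hd.2] at h1 h2 h3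
      have he' : e ∣ 2 * a d := by exact_mod_cast he
      have hec : e ∣ c := (Nat.pow_dvd_pow_iff two_ne_zero).mp hen
      have hcop : ∀ {r : ℕ}, r.Prime → r ≠ 2 → ¬ (r ∣ a d ∧ r ∣ c) → Nat.Coprime e r := by
        intro r hr hr2 h
        refine ((hr.coprime_iff_not_dvd).mpr fun hre => h ⟨?_, hre.trans hec⟩).symm
        refine (hr.dvd_mul.mp (hre.trans he')).resolve_left fun h => hr2 ?_
        exact (Nat.prime_dvd_prime_iff_eq hr Nat.prime_two).mp h
      have hcop2 : Nat.Coprime (e ^ 2) n :=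
        Nat.Coprime.pow 2 g (Nat.Coprime.mul_right (hcop hp hp2 h2) (hcop hq hq2 h3))
      have h16 : e ^ 2 ∣ 16 * n := by
        have h5 : 16 * n = (2 * a d) ^ 2 + c ^ 2 * (4 * d) := by
          calc 16 * n = 4 * (4 * n) := by ring
            _ = 4 * (a d ^ 2 + d * c ^ 2) := by rw [hn, h1]
            _ = _ := by ring
        rw [h5]
        exact dvd_add (pow_dvd_pow_of_dvd he' 2) (hen.mul_right _)
      have := Nat.le_of_dvd (by norm_num) (hcop2.dvd_of_dvd_mul_right h16)
      nlinarith
  calc (D.card : ℝ) = ∑ c ∈ Finset.Icc 1 ⌊2 * s / x⌋₊,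
        (((D.filter fun d => b d = c).card : ℕ) : ℝ) := by
        rw [Finset.card_eq_sum_card_fiberwise hbmax]; push_cast; rfl
    _ ≤ ∑ _c ∈ Finset.Icc 1 ⌊2 * s / x⌋₊, τ * (8 * X / s + 1) := Finset.sum_le_sum hfib
    _ = ⌊2 * s / x⌋₊ * (τ * (8 * X / s + 1)) := by simp
    _ ≤ 2 * s / x * (τ * (8 * X / s + 1)) := by
        gcongr
        exact Nat.floor_le (by positivity)
    _ = τ * (16 * x + 2 * s / x) := by
        rw [← hxx]; field_simp; ring

open Filter in
theorem eventually_mul_rpow_le (K : ℝ) {a b : ℝ} (hab : a < b) :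
    ∀ᶠ X : ℝ in atTop, K * X ^ a ≤ X ^ b := by
  filter_upwards [(tendsto_rpow_atTop (sub_pos.mpr hab)).eventually_ge_atTop K,
    eventually_gt_atTop 0] with X hX hX0
  calc K * X ^ a ≤ X ^ (b - a) * X ^ a := by gcongr
    _ = X ^ b := by rw [← Real.rpow_add hX0]; congr 1; ring

/-- The odd primes not exceeding `y`. -/
noncomputable def oddPrimesLE (y : ℝ) : Finset ℕ :=
  (Finset.range (⌊y⌋₊ + 1)).filter fun p => p.Prime ∧ p ≠ 2

theorem mem_oddPrimesLE {y : ℝ} (hy : 0 ≤ y) {p : ℕ} :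
    p ∈ oddPrimesLE y ↔ (p : ℝ) ≤ y ∧ p.Prime ∧ p ≠ 2 := by
  rw [oddPrimesLE, Finset.mem_filter, Finset.mem_range, Nat.lt_succ_iff, Nat.le_floor_iff hy]

theorem card_oddPrimesLE_le {y : ℝ} (hy : 0 ≤ y) : ((oddPrimesLE y).card : ℝ) ≤ y := by
  have h : oddPrimesLE y ⊆ Finset.Icc 1 ⌊y⌋₊ := fun p hp => by
    rw [mem_oddPrimesLE hy] at hp
    exact Finset.mem_Icc.mpr ⟨hp.2.1.one_lt.le, Nat.le_floor hp.1⟩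
  have h1 := Finset.card_le_card h
  rw [Nat.card_Icc, Nat.add_sub_cancel] at h1
  exact (Nat.cast_le.mpr h1).trans (Nat.floor_le hy)

theorem primeCounting_le_card_oddPrimesLE (y : ℝ) :
    Nat.primeCounting ⌊y⌋₊ ≤ (oddPrimesLE y).card + 1 := by
  rw [Nat.primeCounting, Nat.primeCounting', Nat.count_eq_card_filter_range]
  refine le_trans (Finset.card_le_card (t := insert 2 (oddPrimesLE y)) fun p hp => ?_)
    (Finset.card_insert_le _ _)
  rw [Finset.mem_filter] at hp
  rw [Finset.mem_insert, oddPrimesLE, Finset.mem_filter]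
  tauto

open Filter in
theorem eventually_rpow_le_card_oddPrimesLE {η : ℝ} (hη : 0 < η) (hη1 : η ≤ 1) :
    ∀ᶠ x : ℝ in atTop, x ^ (1 - η) ≤ (oddPrimesLE x).card := by
  have h1 := (isLittleO_log_rpow_atTop hη).bound (show (0 : ℝ) < 1 / 8 by norm_num)
  have h2 := (isLittleO_log_rpow_atTop one_pos).bound (show (0 : ℝ) < 1 / 16 by norm_num)
  filter_upwards [h1, h2, eventually_ge_atTop 8] with x hx1 hx2 hx
  have hx0 : 0 < x := by linarith
  have hlog : 0 < Real.log x := Real.log_pos (by linarith)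
  rw [Real.norm_of_nonneg hlog.le, Real.norm_of_nonneg (by positivity)] at hx1 hx2
  rw [Real.rpow_one] at hx2
  have h3 : Real.log (x + 2) ≤ 2 * Real.log x := by
    rw [← Real.log_rpow hx0]
    refine Real.log_le_log (by linarith) ?_
    norm_num
    nlinarith
  have h4 := Chebyshev.pi_ge' (x := x) (by linarith)
  have h5 := Real.log_two_gt_d9
  have h6 : 2 * x ^ (1 - η) ≤ ((x - 1) * Real.log 2 - Real.log (x + 2)) / Real.log x := by
    rw [le_div_iff₀ hlog]
    calc 2 * x ^ (1 - η) * Real.log x ≤ 2 * x ^ (1 - η) * (1 / 8 * x ^ η) := by gcongr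
      _ = 1 / 4 * (x ^ (1 - η) * x ^ η) := by ring
      _ = 1 / 4 * x := by rw [← Real.rpow_add hx0]; simp
      _ ≤ _ := by nlinarith
  have h7 : (1 : ℝ) ≤ x ^ (1 - η) := Real.one_le_rpow (by linarith) (by linarith)
  have h8 : ((Nat.primeCounting ⌊x⌋₊ : ℕ) : ℝ) ≤ (oddPrimesLE x).card + 1 := by
    exact_mod_cast primeCounting_le_card_oddPrimesLE x
  linarith

open Filter in
theorem eventually_rpow_le_card_oddPrimesLE_rpow {c η : ℝ} (hc : 0 < c) (hη : 0 < η)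
    (hηc : η ≤ c) : ∀ᶠ X : ℝ in atTop, X ^ (c - η) ≤ (oddPrimesLE (X ^ c)).card := by
  filter_upwards [(tendsto_rpow_atTop hc).eventually
    (eventually_rpow_le_card_oddPrimesLE (div_pos hη hc) ((div_le_one hc).mpr hηc)),
    eventually_gt_atTop 0] with X hX hX0
  rwa [← Real.rpow_mul hX0.le, mul_sub, mul_one, mul_div_cancel₀ _ hc.ne'] at hX

open scoped NumberTheorySymbols in
theorem card_lt_of_sum_jacobiSym {d : ℕ} (hd : d ≠ 0) {W : Finset ℕ}
    (hW : ∀ p ∈ W, p.Prime ∧ p ≠ 2)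
    (h : -2 * ∑ p ∈ W, J(-(d : ℤ) | p) < (W.card : ℤ)) :
    W.card < 4 * (W.filter fun p => J(-(d : ℤ) | p) = 1).card + 2 * d.divisors.card := by
  have h1 : ((W.filter fun p => J(-(d : ℤ) | p) = 0).card : ℤ) ≤ d.divisors.card := by
    refine Nat.cast_le.mpr (Finset.card_le_card fun p hp => ?_)
    rw [Finset.mem_filter, jacobiSym.eq_zero_iff, Int.neg_gcd, Int.gcd_natCast_natCast] at hp
    refine Nat.mem_divisors.mpr ⟨?_, hd⟩
    by_contra hpd
    exact hp.2.2 ((((hW p hp.1).1.coprime_iff_not_dvd).mpr hpd).symm)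
  have h2 : (W.card : ℤ) ≤ 2 * (W.filter fun p => J(-(d : ℤ) | p) = 1).card
      + (W.filter fun p => J(-(d : ℤ) | p) = 0).card - ∑ p ∈ W, J(-(d : ℤ) | p) := by
    rw [Finset.card_eq_sum_ones, Finset.card_filter, Finset.card_filter]
    push_cast
    rw [Finset.mul_sum, ← Finset.sum_add_distrib, ← Finset.sum_sub_distrib]
    refine Finset.sum_le_sum fun p _ => ?_
    rcases jacobiSym.trichotomy (-(d : ℤ)) p with h | h | h <;> rw [h] <;> norm_num
  zify
  linarith

/-- The squarefree `d ∈ [X, 2X)` with too few split primes in `W`. -/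
noncomputable def fewSplit (X : ℝ) (W : Finset ℕ) : Finset ℕ :=
  (Finset.range (⌊2 * X⌋₊ + 1)).filter fun d =>
    Squarefree d ∧ (W.card : ℤ) ≤ -2 * ∑ p ∈ W, jacobiSym (-(d : ℤ)) p

open Filter in
theorem eventually_card_fewSplit_le {c δ : ℝ} (hc : 0 < c) (hδ : 0 < δ) :
    ∀ᶠ X : ℝ in atTop, ((fewSplit X (oddPrimesLE (X ^ c))).card : ℝ) ≤ X ^ δ := by
  set k := ⌈4 / c⌉₊ with hk
  have hck : 4 ≤ c * k := by
    have := Nat.le_ceil (4 / c)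
    rw [div_le_iff₀ hc] at this
    linarith
  have hk0 : (0 : ℝ) < k := by
    by_contra h
    nlinarith
  set η := min c (δ / (2 * k)) with hη
  have hη0 : 0 < η := lt_min hc (by positivity)
  have hηk : η * k ≤ δ / 2 := by
    have : η ≤ δ / (2 * k) := min_le_right _ _
    calc η * k ≤ δ / (2 * k) * k := by gcongr
      _ = δ / 2 := by field_simp
  filter_upwards [eventually_rpow_le_card_oddPrimesLE_rpow hc hη0 (min_le_left _ _),
    eventually_mul_rpow_le (4 ^ k * k.factorial * 34) (show δ / 2 < δ by linarith),
    eventually_ge_atTop 1] with X hW hX hX1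
  have hX0 : 0 < X := by linarith
  have hXc : 0 ≤ X ^ c := by positivity
  have h1 := card_mul_pow_le_of_sum_jacobiSym_le (D := fewSplit X (oddPrimesLE (X ^ c)))
    (W := oddPrimesLE (X ^ c)) (Y := ⌊2 * X⌋₊) (P := ⌊X ^ c⌋₊) (fun d hd => by
      rw [fewSplit, Finset.mem_filter, Finset.mem_range, Nat.lt_succ_iff] at hd
      exact ⟨hd.2.1, hd.1⟩) (fun p hp => by
      rw [mem_oddPrimesLE hXc] at hp
      exact ⟨hp.2.1, hp.2.2, Nat.le_floor hp.1⟩) (fun d hd => by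
      rw [fewSplit, Finset.mem_filter] at hd
      exact hd.2.2) k
  set b := (fewSplit X (oddPrimesLE (X ^ c))).card
  have h2 : (b : ℝ) * ((oddPrimesLE (X ^ c)).card : ℝ) ^ k
      ≤ 4 ^ k * k.factorial * ((⌊X ^ c⌋₊ : ℝ) ^ k + 1 + 4 * (⌊2 * X⌋₊ : ℝ) ^ 3) := by
    exact_mod_cast h1
  have h3 : ((⌊X ^ c⌋₊ : ℝ) ^ k + 1 + 4 * (⌊2 * X⌋₊ : ℝ) ^ 3) ≤ 34 * X ^ (c * k) := by
    have e1 : (⌊X ^ c⌋₊ : ℝ) ^ k ≤ X ^ (c * k) := by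
      rw [Real.rpow_mul hX0.le, Real.rpow_natCast]
      gcongr
      exact Nat.floor_le hXc
    have e2 : (1 : ℝ) ≤ X ^ (c * k) := Real.one_le_rpow hX1 (by positivity)
    have e3 : (⌊2 * X⌋₊ : ℝ) ^ 3 ≤ 8 * X ^ 3 := by
      calc (⌊2 * X⌋₊ : ℝ) ^ 3 ≤ (2 * X) ^ 3 := by gcongr; exact Nat.floor_le (by positivity)
        _ = _ := by ring
    have e4 : X ^ 3 ≤ X ^ (c * k) := by
      rw [← Real.rpow_natCast]
      exact Real.rpow_le_rpow_of_exponent_le hX1 (by push_cast; linarith)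
    linarith
  have h4 : X ^ ((c - η) * k) ≤ ((oddPrimesLE (X ^ c)).card : ℝ) ^ k := by
    rw [Real.rpow_mul hX0.le, Real.rpow_natCast]
    gcongr
  have h5 : (b : ℝ) * X ^ ((c - η) * k) ≤ (4 ^ k * k.factorial * 34 * X ^ (η * k)) * X ^ ((c - η) * k) := by
    calc (b : ℝ) * X ^ ((c - η) * k) ≤ b * ((oddPrimesLE (X ^ c)).card : ℝ) ^ k := by gcongr
      _ ≤ 4 ^ k * k.factorial * (34 * X ^ (c * k)) := h2.trans (by gcongr)
      _ = 4 ^ k * k.factorial * 34 * (X ^ (η * k) * X ^ ((c - η) * k)) := by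
        rw [← Real.rpow_add hX0]
        ring_nf
      _ = _ := by ring
  calc (b : ℝ) ≤ 4 ^ k * k.factorial * 34 * X ^ (η * k) := le_of_mul_le_mul_right h5 (by positivity)
    _ ≤ 4 ^ k * k.factorial * 34 * X ^ (δ / 2) := by
      gcongr
    _ ≤ X ^ δ := hX

open scoped Classical in
/-- The pairs of distinct primes of `W` admitting a primitive solution for `d`. -/
noncomputable def primitivePairs (g : ℕ) (W : Finset ℕ) (d : ℕ) : Finset (ℕ × ℕ) :=
  (W ×ˢ W).filter fun z => z.1 ≠ z.2 ∧ PrimitiveSolution g d z.1 z.2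

theorem hneg_mul_card_filter_sq_le {g d : ℕ} (hd : Squarefree d) {W : Finset ℕ}
    (hW : ∀ p ∈ W, p.Prime ∧ p ≠ 2) :
    hneg g d * (W.filter fun p => jacobiSym (-(d : ℤ)) p = 1).card ^ 2 ≤
      Nat.card (ClassGroup (𝓞 (Kneg d))) *
        ((W.filter fun p => jacobiSym (-(d : ℤ)) p = 1).card + (primitivePairs g W d).card) := by
  classical
  set Q := W.filter fun p => jacobiSym (-(d : ℤ)) p = 1 with hQ
  have h := hneg_mul_card_sq_le (g := g) hd Q fun p hp => by
    rw [hQ, Finset.mem_filter] at hp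
    obtain ⟨hpp, hp2⟩ := hW p hp.1
    have : Fact p.Prime := ⟨hpp⟩
    have hpd : ¬ p ∣ d := by
      intro hpd
      have h0 : jacobiSym (-(d : ℤ)) p = 0 := by
        rw [jacobiSym.eq_zero_iff, Int.neg_gcd, Int.gcd_natCast_natCast, Nat.gcd_eq_right hpd]
        exact ⟨hpp.ne_zero, hpp.one_lt.ne'⟩
      rw [hp.2] at h0
      norm_num at h0
    obtain ⟨t, ht⟩ := ZMod.isSquare_of_jacobiSym_eq_one hp.2
    obtain ⟨u, rfl⟩ := ZMod.intCast_surjective t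
    refine ⟨hpp, hp2, hpd, u, ?_⟩
    rw [← ZMod.intCast_zmod_eq_zero_iff_dvd]
    push_cast at ht ⊢
    linear_combination -ht
  refine h.trans (Nat.mul_le_mul_left _ ?_)
  rw [Finset.filter_or]
  refine (Finset.card_union_le _ _).trans (add_le_add (le_of_eq ?_) ?_)
  · rw [← Finset.diag_eq_filter, Finset.diag_card]
  · exact Finset.card_le_card (Finset.filter_subset_filter _
      (Finset.product_subset_product (Finset.filter_subset _ _) (Finset.filter_subset _ _)))

theorem PrimitiveSolution.le {g d p q : ℕ} (hp : p.Prime) (hg : g ≠ 0)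
    (h : PrimitiveSolution g d p q) : d ≤ 4 * (p * q) ^ g := by
  obtain ⟨a, b, h1, h2, -⟩ := h
  have hb : 0 < b := by
    refine Nat.pos_of_ne_zero fun hb => h2 ⟨?_, by rw [hb]; exact dvd_zero _⟩
    rw [hb] at h1
    refine hp.dvd_of_dvd_pow (n := 2) ?_
    rw [show a ^ 2 = 4 * (p * q) ^ g by rw [h1]; ring]
    exact ((dvd_mul_right p q).trans (dvd_pow_self _ hg)).mul_left 4
  rw [h1]
  calc d ≤ d * b ^ 2 := Nat.le_mul_of_pos_right _ (pow_pos hb 2)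
    _ ≤ a ^ 2 + d * b ^ 2 := Nat.le_add_left _ _

/-- The `d ∈ [X, 2X)` with more than `X ^ c` primitive pairs of primes up to `X ^ c`. -/
noncomputable def manyPairs (g : ℕ) (c X : ℝ) : Finset ℕ :=
  open scoped Classical in
  (Finset.range (⌊2 * X⌋₊ + 1)).filter fun d =>
    X ≤ d ∧ (d : ℝ) < 2 * X ∧ X ^ c < (primitivePairs g (oddPrimesLE (X ^ c)) d).card

theorem mul_rpow_le_of_mem_oddPrimesLE {g : ℕ} {c X : ℝ} (hX : 0 < X) {p q : ℕ}
    (hp : p ∈ oddPrimesLE (X ^ c)) (hq : q ∈ oddPrimesLE (X ^ c)) :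
    ((p : ℝ) * q) ^ g ≤ X ^ (2 * g * c) := by
  rw [mem_oddPrimesLE (by positivity)] at hp hq
  calc ((p : ℝ) * q) ^ g ≤ (X ^ c * X ^ c) ^ g := by
        gcongr
        · exact hp.1
        · exact hq.1
    _ = X ^ (2 * g * c) := by
        rw [← Real.rpow_add hX, ← Real.rpow_natCast, ← Real.rpow_mul hX.le]
        ring_nf

open Filter in
theorem eventually_manyPairs_eq_empty {g : ℕ} (hg : g ≠ 0) {c : ℝ} (hgc : 2 * g * c < 1) :
    ∀ᶠ X : ℝ in atTop, manyPairs g c X = ∅ := by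
  filter_upwards [eventually_mul_rpow_le 5 hgc, eventually_gt_atTop 0] with X hX hX0
  rw [Finset.eq_empty_iff_forall_notMem]
  intro d hd
  rw [manyPairs, Finset.mem_filter] at hd
  obtain ⟨-, h1, -, h2⟩ := hd
  have h3 : 0 < (primitivePairs g (oddPrimesLE (X ^ c)) d).card := by
    have : 0 < X ^ c := by positivity
    exact_mod_cast this.trans h2
  obtain ⟨⟨p, q⟩, hz⟩ := Finset.card_pos.mp h3
  simp only [primitivePairs, Finset.mem_filter, Finset.mem_product] at hz
  have h4 := mul_rpow_le_of_mem_oddPrimesLE (g := g) hX0 hz.1.1 hz.1.2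
  have hp := ((mem_oddPrimesLE (by positivity)).mp hz.1.1).2.1
  have h5 : (d : ℝ) ≤ 4 * ((p : ℝ) * q) ^ g := by exact_mod_cast hz.2.2.le hp hg
  have h6 : 0 < X ^ (2 * g * c) := by positivity
  rw [Real.rpow_one] at hX
  linarith

open Filter in
theorem eventually_card_manyPairs_le {g : ℕ} (hg : g ≠ 0) {c δ : ℝ} (hc : 0 < c) (hδ : 0 < δ) :
    ∀ᶠ X : ℝ in atTop, ((manyPairs g c X).card : ℝ)
      ≤ X ^ δ * (X ^ (1 / 2 + c) + X ^ ((g + 1) * c - 1 / 2)) := by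
  classical
  have hgR : (0 : ℝ) < g := by exact_mod_cast Nat.pos_of_ne_zero hg
  set η := δ / (4 * g * c) with hη
  have hη0 : 0 < η := by positivity
  obtain ⟨C, hC1, hC⟩ := exists_card_divisors_le_rpow hη0
  filter_upwards [eventually_mul_rpow_le (C * 4 ^ η * 16) (show δ / 2 < δ by linarith),
    eventually_ge_atTop 1] with X hX hX1
  have hX0 : 0 < X := by linarith
  set W := oddPrimesLE (X ^ c) with hW
  set B := manyPairs g c X with hB
  have hBmem : ∀ d ∈ B, X ≤ d ∧ (d : ℝ) < 2 * X ∧ X ^ c < (primitivePairs g W d).card := by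
    intro d hd
    rw [hB, manyPairs, Finset.mem_filter] at hd
    exact hd.2
  set τ := C * 4 ^ η * X ^ (δ / 2) with hτ
  have hτ0 : 0 ≤ τ := by positivity
  have hdiv : ∀ p ∈ W, ∀ q ∈ W, ∀ b : ℕ, 0 < b → (b : ℝ) ^ 2 * X ≤ 4 * (p * q : ℝ) ^ g →
      ((b ^ 2).divisors.card : ℝ) ≤ τ := by
    intro p hp q hq b hb h
    have h1 := mul_rpow_le_of_mem_oddPrimesLE (g := g) hX0 hp hq
    have h2 : (b : ℝ) ^ 2 ≤ 4 * X ^ (2 * g * c) := by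
      have : (b : ℝ) ^ 2 * 1 ≤ b ^ 2 * X := by gcongr
      linarith
    refine (hC _ (pow_pos hb 2)).trans ?_
    rw [hτ, mul_assoc]
    gcongr
    push_cast
    calc ((b : ℝ) ^ 2) ^ η ≤ (4 * X ^ (2 * g * c)) ^ η := by gcongr
      _ = 4 ^ η * X ^ (δ / 2) := by
        rw [Real.mul_rpow (by norm_num) (by positivity), ← Real.rpow_mul hX0.le]
        congr 2
        rw [hη]; field_simp; norm_num
  have hpair : ∀ z ∈ (W ×ˢ W).filter (fun z => z.1 ≠ z.2),
      ((B.filter fun d => PrimitiveSolution g d z.1 z.2).card : ℝ)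
        ≤ τ * (16 * X ^ (1 / 2 : ℝ) + 2 * X ^ (g * c - 1 / 2)) := by
    rintro ⟨p, q⟩ hz
    rw [Finset.mem_filter, Finset.mem_product] at hz
    obtain ⟨⟨hp, hq⟩, -⟩ := hz
    have hp' := (mem_oddPrimesLE (by positivity)).mp hp
    have hq' := (mem_oddPrimesLE (by positivity)).mp hq
    refine (card_primitiveSolution_le hp'.2.1 hq'.2.1 hp'.2.2 hq'.2.2 hg hX0
      (B.filter fun d => PrimitiveSolution g d p q) (fun d hd => ?_) hτ0
      (hdiv p hp q hq)).trans ?_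
    · rw [Finset.mem_filter] at hd
      exact ⟨(hBmem d hd.1).1, (hBmem d hd.1).2.1, hd.2⟩
    · gcongr
      · rw [Real.sqrt_eq_rpow]
      · rw [Real.rpow_sub hX0, Real.sqrt_eq_rpow X, mul_div_assoc]
        gcongr
        calc Real.sqrt (((p : ℝ) * q) ^ g) ≤ Real.sqrt (X ^ (2 * g * c)) :=
              Real.sqrt_le_sqrt (mul_rpow_le_of_mem_oddPrimesLE hX0 hp hq)
          _ = X ^ (g * c) := by
              rw [Real.sqrt_eq_rpow, ← Real.rpow_mul hX0.le]
              congr 1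
              ring
  have hcount : (B.card : ℝ) * X ^ c
      ≤ (X ^ c * X ^ c) * (τ * (16 * X ^ (1 / 2 : ℝ) + 2 * X ^ (g * c - 1 / 2))) := by
    calc (B.card : ℝ) * X ^ c = ∑ _d ∈ B, X ^ c := by rw [Finset.sum_const, nsmul_eq_mul]
      _ ≤ ∑ d ∈ B, ((primitivePairs g W d).card : ℝ) :=
          Finset.sum_le_sum fun d hd => (hBmem d hd).2.2.le
      _ = ∑ z ∈ (W ×ˢ W).filter (fun z => z.1 ≠ z.2),
            ((B.filter fun d => PrimitiveSolution g d z.1 z.2).card : ℝ) := by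
          simp_rw [primitivePairs, ← Finset.filter_filter, Finset.card_filter, Nat.cast_sum]
          exact Finset.sum_comm
      _ ≤ ∑ _z ∈ (W ×ˢ W).filter (fun z => z.1 ≠ z.2),
            τ * (16 * X ^ (1 / 2 : ℝ) + 2 * X ^ (g * c - 1 / 2)) := Finset.sum_le_sum hpair
      _ ≤ (X ^ c * X ^ c) * (τ * (16 * X ^ (1 / 2 : ℝ) + 2 * X ^ (g * c - 1 / 2))) := by
          rw [Finset.sum_const, nsmul_eq_mul]
          refine mul_le_mul_of_nonneg_right ?_ (by positivity)
          have h1 := Finset.card_filter_le (W ×ˢ W) (fun z => z.1 ≠ z.2)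
          rw [Finset.card_product] at h1
          have h2 : (W.card : ℝ) ≤ X ^ c := card_oddPrimesLE_le (by positivity)
          calc _ ≤ ((W.card * W.card : ℕ) : ℝ) := Nat.cast_le.mpr h1
            _ ≤ X ^ c * X ^ c := by push_cast; gcongr
  have hXc : 0 < X ^ c := by positivity
  have h1 : (B.card : ℝ) ≤ X ^ c * (τ * (16 * X ^ (1 / 2 : ℝ) + 2 * X ^ (g * c - 1 / 2))) := by
    refine le_of_mul_le_mul_right (hcount.trans (le_of_eq ?_)) hXc
    ring
  have e1 : X ^ (1 / 2 + c) = X ^ c * X ^ (1 / 2 : ℝ) := by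
    rw [← Real.rpow_add hX0]; congr 1; ring
  have e2 : X ^ (((g : ℝ) + 1) * c - 1 / 2) = X ^ c * X ^ ((g : ℝ) * c - 1 / 2) := by
    rw [← Real.rpow_add hX0]; congr 1; ring
  calc (B.card : ℝ) ≤ X ^ c * (τ * (16 * X ^ (1 / 2 : ℝ) + 2 * X ^ (g * c - 1 / 2))) := h1
    _ ≤ X ^ c * (τ * (16 * X ^ (1 / 2 : ℝ) + 16 * X ^ (g * c - 1 / 2))) := by gcongr; norm_num
    _ = (C * 4 ^ η * 16 * X ^ (δ / 2))
          * (X ^ (1 / 2 + c) + X ^ (((g : ℝ) + 1) * c - 1 / 2)) := by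
        rw [e1, e2, hτ]; ring
    _ ≤ _ := by gcongr

open Filter in
theorem eventually_hneg_le {g : ℕ} {c δ : ℝ} (hc : 0 < c) (hδ : 0 < δ) :
    ∀ᶠ X : ℝ in atTop, ∀ d : ℕ, Squarefree d → X ≤ d → (d : ℝ) < 2 * X →
      d ∉ fewSplit X (oddPrimesLE (X ^ c)) → d ∉ manyPairs g c X →
      (hneg g d : ℝ) ≤ X ^ (1 / 2 - c + δ) := by
  set η := min (c / 2) (δ / 4) with hη
  have hη0 : 0 < η := lt_min (by linarith) (by linarith)
  have hηc : η ≤ c / 2 := min_le_left _ _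
  have hηδ : η ≤ δ / 4 := min_le_right _ _
  obtain ⟨C, hC1, hC⟩ := exists_card_divisors_le_rpow hη0
  obtain ⟨H, hH0, hH⟩ := exists_card_classGroup_le hη0
  filter_upwards [eventually_rpow_le_card_oddPrimesLE_rpow hc (half_pos hη0) (by linarith),
    eventually_mul_rpow_le (4 * C * 2 ^ η) (show η < c - η / 2 by linarith),
    eventually_mul_rpow_le (H * 2 ^ (1 / 2 + η) * 72)
      (show 1 / 2 - c + 3 * η < 1 / 2 - c + δ by linarith),
    eventually_ge_atTop 1] with X hW hX2 hX3 hX1 d hd hdX hd2X hfew hmany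
  have hX0 : 0 < X := by linarith
  set W := oddPrimesLE (X ^ c) with hWdef
  have hWp : ∀ p ∈ W, p.Prime ∧ p ≠ 2 := fun p hp =>
    ((mem_oddPrimesLE (by positivity)).mp hp).2
  have hdrange : d ∈ Finset.range (⌊2 * X⌋₊ + 1) :=
    Finset.mem_range.mpr (Nat.lt_succ_of_le (Nat.le_floor hd2X.le))
  have h1 : -2 * ∑ p ∈ W, jacobiSym (-(d : ℤ)) p < (W.card : ℤ) := by
    by_contra h
    exact hfew (Finset.mem_filter.mpr ⟨hdrange, hd, not_lt.mp h⟩)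
  have h2 : ((primitivePairs g W d).card : ℝ) ≤ X ^ c := by
    by_contra h
    refine hmany ?_
    rw [manyPairs, Finset.mem_filter]
    exact ⟨hdrange, hdX, hd2X, not_le.mp h⟩
  have h3 := card_lt_of_sum_jacobiSym hd.ne_zero hWp h1
  have h4 := hneg_mul_card_filter_sq_le (g := g) hd hWp
  set Q := W.filter fun p => jacobiSym (-(d : ℤ)) p = 1 with hQ
  have hτ : (d.divisors.card : ℝ) ≤ C * (2 ^ η * X ^ η) := by
    refine (hC d (Nat.pos_of_ne_zero hd.ne_zero)).trans ?_
    rw [← Real.mul_rpow (by norm_num) hX0.le]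
    gcongr
  have h3' : (W.card : ℝ) < 4 * Q.card + 2 * d.divisors.card := by exact_mod_cast h3
  have hQ1 : X ^ (c - η) / 8 ≤ Q.card := by
    have : X ^ (c - η) ≤ X ^ (c - η / 2) := Real.rpow_le_rpow_of_exponent_le hX1 (by linarith)
    linarith
  set m := X ^ (c - η) / 8 with hm
  have hm0 : 0 < m := by positivity
  have h4' : (hneg g d : ℝ) * (Q.card : ℝ) ^ 2
      ≤ H * (d : ℝ) ^ (1 / 2 + η) * (Q.card + X ^ c) := by
    calc (hneg g d : ℝ) * (Q.card : ℝ) ^ 2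
        ≤ (Nat.card (ClassGroup (𝓞 (Kneg d))) : ℝ) * (Q.card + (primitivePairs g W d).card) := by
          exact_mod_cast h4
      _ ≤ _ := by
          gcongr
          exact hH d hd
  have hQ0 : (0 : ℝ) < Q.card := hm0.trans_le hQ1
  have h5 : (hneg g d : ℝ) ≤ H * (d : ℝ) ^ (1 / 2 + η) * (1 / m + X ^ c / m ^ 2) := by
    calc (hneg g d : ℝ) ≤ H * (d : ℝ) ^ (1 / 2 + η) * (Q.card + X ^ c) / (Q.card : ℝ) ^ 2 := by
          rwa [le_div_iff₀ (by positivity)]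
      _ = H * (d : ℝ) ^ (1 / 2 + η) * (1 / Q.card + X ^ c / (Q.card : ℝ) ^ 2) := by
          field_simp
      _ ≤ _ := by gcongr
  have h6 : 1 / m + X ^ c / m ^ 2 ≤ 72 * X ^ (2 * η - c) := by
    have e1 : X ^ (2 * η - c) * X ^ (c - η) = X ^ η := by rw [← Real.rpow_add hX0]; congr 1; ring
    have e2 : X ^ η * X ^ (c - η) = X ^ c := by rw [← Real.rpow_add hX0]; congr 1; ring
    have e3 : (1 : ℝ) ≤ X ^ η := Real.one_le_rpow hX1 hη0.le
    have hY : 0 < X ^ (c - η) := by positivity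
    have e4 : X ^ c / m ^ 2 = 64 * X ^ (2 * η - c) := by
      rw [hm, ← e2, ← e1]
      field_simp
      norm_num
    have e5 : 1 / m ≤ 8 * X ^ (2 * η - c) := by
      rw [div_le_iff₀ hm0, hm]
      linarith
    linarith
  calc (hneg g d : ℝ) ≤ H * (d : ℝ) ^ (1 / 2 + η) * (1 / m + X ^ c / m ^ 2) := h5
    _ ≤ H * (2 * X) ^ (1 / 2 + η) * (72 * X ^ (2 * η - c)) := by gcongr
    _ = H * 2 ^ (1 / 2 + η) * 72 * (X ^ (1 / 2 + η) * X ^ (2 * η - c)) := by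
        rw [Real.mul_rpow (by norm_num) hX0.le]; ring
    _ = H * 2 ^ (1 / 2 + η) * 72 * X ^ (1 / 2 - c + 3 * η) := by
        rw [← Real.rpow_add hX0]; ring_nf
    _ ≤ _ := hX3

theorem exists_le_mul_of_eventually_le {f v : ℕ → ℝ} (hv : ∀ n, 1 ≤ v n)
    (h : ∀ᶠ n in Filter.atTop, f n ≤ v n) : ∃ C : ℝ, 0 < C ∧ ∀ n, f n ≤ C * v n := by
  obtain ⟨N, hN⟩ := Filter.eventually_atTop.mp h
  have hs : 0 ≤ ∑ i ∈ Finset.range N, |f i| := Finset.sum_nonneg fun i _ => abs_nonneg _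
  refine ⟨1 + ∑ i ∈ Finset.range N, |f i|, by positivity, fun n => ?_⟩
  have hv0 : 0 ≤ v n := zero_le_one.trans (hv n)
  by_cases hn : N ≤ n
  · have := hN n hn
    nlinarith [mul_nonneg hs hv0]
  · have h1 := Finset.single_le_sum (f := fun i => |f i|) (fun i _ => abs_nonneg _)
      (Finset.mem_range.mpr (not_le.mp hn))
    have h2 := le_abs_self (f n)
    have h3 := hv n
    nlinarith [mul_le_mul_of_nonneg_left h3 hs]

theorem hneg_le_card_classGroup (g d : ℕ) :
    hneg g d ≤ Nat.card (ClassGroup (𝓞 (Kneg d))) :=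
  Nat.card_le_card_of_injective _ Subtype.val_injective

/-- The squarefree integers in `[X, 2X)`. -/
noncomputable def dyadicSquarefree (X : ℝ) : Finset ℕ :=
  (Finset.range (⌊2 * X⌋₊ + 1)).filter fun d => Squarefree d ∧ X ≤ d ∧ (d : ℝ) < 2 * X

open Filter in
theorem eventually_sum_dyadic_le {g : ℕ} (hg : g ≠ 0) {a c k E ε : ℝ} (hk : 0 ≤ k)
    (hε : 0 < ε) (ha : 2 * g * a = 1) (hac : a < c)
    (h1 : ∀ x, a ≤ x → x ≤ c → 1 / 2 + x + k * (1 / 2 - x) ≤ E)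
    (h2 : ∀ x, a ≤ x → x ≤ c → (g + 1) * x - 1 / 2 + k * (1 / 2 - x) ≤ E)
    (h3 : 1 + k * (1 / 2 - c) ≤ E) (h4 : k / 2 ≤ E) :
    ∀ᶠ X : ℝ in atTop, ∑ d ∈ dyadicSquarefree X, (hneg g d : ℝ) ^ k ≤ X ^ (E + ε) := by
  have hgR : (0 : ℝ) < g := by exact_mod_cast Nat.pos_of_ne_zero hg
  have ha0 : 0 < a := by
    by_contra h
    nlinarith
  set δ := ε / (4 * (1 + k)) with hδ
  have hδ0 : 0 < δ := by positivity
  have hδk : δ + k * δ = ε / 4 := by rw [hδ]; field_simp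
  obtain ⟨m, hm⟩ := exists_nat_gt (max 1 (max ((c - a) / a) ((c - a) * (4 * k) / ε)))
  have hm0 : (0 : ℝ) < m := by linarith [le_max_left 1 (max ((c - a) / a) ((c - a) * (4 * k) / ε))]
  have hm1 : (c - a) / a < m := ((le_max_left _ _).trans (le_max_right _ _)).trans_lt hm
  have hm2 : (c - a) * (4 * k) / ε < m := ((le_max_right _ _).trans (le_max_right _ _)).trans_lt hm
  set η := (c - a) / m with hη
  have hη0 : 0 < η := div_pos (by linarith) hm0
  have hηm : m * η = c - a := by rw [hη]; field_simp
  have hηa : η < a := by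
    rw [div_lt_iff₀ ha0] at hm1
    rw [hη, div_lt_iff₀ hm0]
    linarith
  have hηk : k * η ≤ ε / 4 := by
    rw [div_lt_iff₀ hε] at hm2
    rw [hη, ← mul_div_assoc, div_le_iff₀ hm0]
    linarith
  set e : ℕ → ℝ := fun j => a + (j - 1) * η with he
  have he0 : ∀ j, 0 < e j := fun j => by
    have : 0 ≤ (j : ℝ) * η := by positivity
    simp only [he]
    linarith
  obtain ⟨H, hH0, hH⟩ := exists_card_classGroup_le (half_pos hδ0)
  have hfew : ∀ᶠ X : ℝ in atTop, ∀ j ∈ Finset.range (m + 2),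
      ((fewSplit X (oddPrimesLE (X ^ e j))).card : ℝ) ≤ X ^ δ :=
    (Filter.eventually_all_finset _).mpr fun j _ => eventually_card_fewSplit_le (he0 j) hδ0
  have hmany : ∀ᶠ X : ℝ in atTop, ∀ j ∈ Finset.range (m + 2),
      ((manyPairs g (e j) X).card : ℝ)
        ≤ X ^ δ * (X ^ (1 / 2 + e j) + X ^ ((g + 1) * e j - 1 / 2)) :=
    (Filter.eventually_all_finset _).mpr fun j _ => eventually_card_manyPairs_le hg (he0 j) hδ0
  have hbound : ∀ᶠ X : ℝ in atTop, ∀ j ∈ Finset.range (m + 2),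
      ∀ d : ℕ, Squarefree d → X ≤ d → (d : ℝ) < 2 * X →
      d ∉ fewSplit X (oddPrimesLE (X ^ e j)) → d ∉ manyPairs g (e j) X →
      (hneg g d : ℝ) ≤ X ^ (1 / 2 - e j + δ) :=
    (Filter.eventually_all_finset _).mpr fun j _ => eventually_hneg_le (he0 j) hδ0
  have hempty := eventually_manyPairs_eq_empty hg (c := e 0) (by
    simp only [he]
    push_cast
    nlinarith)
  filter_upwards [hfew, hmany, hbound, hempty, eventually_ge_atTop 1,
    eventually_mul_rpow_le (H * 2 ^ (1 / 2 + δ / 2)) (show 1 / 2 + δ / 2 < 1 / 2 + δ by linarith),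
    eventually_mul_rpow_le ((m + 2) + (m + 1) * 2 + 3) (show E + ε / 2 < E + ε by linarith)]
    with X hfew hmany hbound hempty hX1 hXH hXE
  have hX0 : 0 < X := by linarith
  set F : ℕ → Finset ℕ := fun j => fewSplit X (oddPrimesLE (X ^ e j)) with hF
  set B : ℕ → Finset ℕ := fun j => manyPairs g (e j) X with hB
  have hrpow : ∀ {d : ℕ} {t : ℝ}, (hneg g d : ℝ) ≤ X ^ t → (hneg g d : ℝ) ^ k ≤ X ^ (t * k) := by
    intro d t h
    rw [Real.rpow_mul hX0.le]
    gcongr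
  have hpoint : ∀ d ∈ dyadicSquarefree X, (hneg g d : ℝ) ^ k
      ≤ (∑ j ∈ Finset.range (m + 2), if d ∈ F j then X ^ ((1 / 2 + δ) * k) else 0)
        + (∑ j ∈ Finset.range (m + 1), if d ∈ B (j + 1) then X ^ ((1 / 2 - e j + δ) * k) else 0)
        + X ^ ((1 / 2 - e (m + 1) + δ) * k) := by
    intro d hd
    rw [dyadicSquarefree, Finset.mem_filter] at hd
    obtain ⟨-, hd, hdX, hd2X⟩ := hd
    have hs1 : ∀ j, 0 ≤ if d ∈ F j then X ^ ((1 / 2 + δ) * k) else 0 := fun j => by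
      split_ifs <;> positivity
    have hs2 : ∀ j, 0 ≤ if d ∈ B (j + 1) then X ^ ((1 / 2 - e j + δ) * k) else 0 := fun j => by
      split_ifs <;> positivity
    have hS1 := Finset.sum_nonneg fun j (_ : j ∈ Finset.range (m + 2)) => hs1 j
    have hS2 := Finset.sum_nonneg fun j (_ : j ∈ Finset.range (m + 1)) => hs2 j
    have hS3 : 0 ≤ X ^ ((1 / 2 - e (m + 1) + δ) * k) := by positivity
    by_cases hFj : ∃ j ∈ Finset.range (m + 2), d ∈ F j
    · obtain ⟨j, hj, hdj⟩ := hFj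
      have h5 := Finset.single_le_sum (fun j _ => hs1 j) hj
      rw [if_pos hdj] at h5
      have h6 : (hneg g d : ℝ) ≤ X ^ (1 / 2 + δ) := by
        calc (hneg g d : ℝ) ≤ Nat.card (ClassGroup (𝓞 (Kneg d))) := by
              exact_mod_cast hneg_le_card_classGroup g d
          _ ≤ H * (d : ℝ) ^ (1 / 2 + δ / 2) := hH d hd
          _ ≤ H * (2 * X) ^ (1 / 2 + δ / 2) := by gcongr
          _ = H * 2 ^ (1 / 2 + δ / 2) * X ^ (1 / 2 + δ / 2) := by
              rw [Real.mul_rpow (by norm_num) hX0.le]; ring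
          _ ≤ _ := hXH
      linarith [hrpow h6]
    · push Not at hFj
      by_cases hBj : ∃ j ∈ Finset.range (m + 1), d ∉ B j ∧ d ∈ B (j + 1)
      · obtain ⟨j, hj, hdj, hdj'⟩ := hBj
        have h5 := Finset.single_le_sum (fun j _ => hs2 j) hj
        rw [if_pos hdj'] at h5
        have hj' : j ∈ Finset.range (m + 2) := by
          rw [Finset.mem_range] at hj ⊢; omega
        linarith [hrpow (hbound j hj' d hd hdX hd2X (hFj j hj') hdj)]
      · push Not at hBj
        have hall : ∀ j, j ≤ m + 1 → d ∉ B j := by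
          intro j
          induction j with
          | zero => intro _; simp [hB, hempty]
          | succ j ih =>
            intro hj
            exact hBj j (Finset.mem_range.mpr (by omega)) (ih (by omega))
        have hj' : m + 1 ∈ Finset.range (m + 2) := Finset.mem_range.mpr (by omega)
        linarith [hrpow (hbound (m + 1) hj' d hd hdX hd2X (hFj _ hj') (hall _ le_rfl))]
  have hind : ∀ (D S : Finset ℕ) (y : ℝ), 0 ≤ y →
      ∑ d ∈ D, (if d ∈ S then y else 0) ≤ S.card * y := by
    intro D S y hy
    rw [← Finset.sum_filter, Finset.sum_const, nsmul_eq_mul]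
    refine mul_le_mul_of_nonneg_right (Nat.cast_le.mpr (Finset.card_le_card fun d hd => ?_)) hy
    exact (Finset.mem_filter.mp hd).2
  have hexp : ∀ {t : ℝ}, t ≤ E + ε / 2 → X ^ t ≤ X ^ (E + ε / 2) := fun h =>
    Real.rpow_le_rpow_of_exponent_le hX1 h
  set Z := X ^ (E + ε / 2) with hZ
  have hT1 : ∀ j ∈ Finset.range (m + 2), ((F j).card : ℝ) * X ^ ((1 / 2 + δ) * k) ≤ Z := by
    intro j hj
    calc ((F j).card : ℝ) * X ^ ((1 / 2 + δ) * k) ≤ X ^ δ * X ^ ((1 / 2 + δ) * k) := by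
          gcongr
          exact hfew j hj
      _ = X ^ (δ + (1 / 2 + δ) * k) := by rw [← Real.rpow_add hX0]
      _ ≤ Z := hexp (by linarith)
  have hT2 : ∀ j ∈ Finset.range (m + 1),
      ((B (j + 1)).card : ℝ) * X ^ ((1 / 2 - e j + δ) * k) ≤ 2 * Z := by
    intro j hj
    rw [Finset.mem_range] at hj
    have hje : e (j + 1) = a + j * η := by simp only [he]; push_cast; ring
    have hje' : e j = e (j + 1) - η := by simp only [he]; push_cast; ring
    have hle1 : a ≤ e (j + 1) := by
      rw [hje]
      have : 0 ≤ (j : ℝ) * η := by positivity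
      linarith
    have hle2 : e (j + 1) ≤ c := by
      have : (j : ℝ) * η ≤ m * η := by
        gcongr
        omega
      rw [hje]
      linarith
    have g1 := h1 _ hle1 hle2
    have g2 := h2 _ hle1 hle2
    calc ((B (j + 1)).card : ℝ) * X ^ ((1 / 2 - e j + δ) * k)
        ≤ (X ^ δ * (X ^ (1 / 2 + e (j + 1)) + X ^ ((g + 1) * e (j + 1) - 1 / 2)))
          * X ^ ((1 / 2 - e j + δ) * k) := by
          gcongr
          exact hmany (j + 1) (Finset.mem_range.mpr (by omega))
      _ = X ^ (δ + (1 / 2 + e (j + 1)) + (1 / 2 - e j + δ) * k)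
          + X ^ (δ + ((g + 1) * e (j + 1) - 1 / 2) + (1 / 2 - e j + δ) * k) := by
          simp only [Real.rpow_add hX0]
          ring
      _ ≤ Z + Z := by
          rw [hje']
          exact add_le_add (hexp (by linarith)) (hexp (by linarith))
      _ = 2 * Z := by ring
  have hT3 : ((dyadicSquarefree X).card : ℝ) * X ^ ((1 / 2 - e (m + 1) + δ) * k) ≤ 3 * Z := by
    have hem : e (m + 1) = c := by simp only [he]; push_cast; linarith
    have hcard : ((dyadicSquarefree X).card : ℝ) ≤ 3 * X := by
      have h5 : (dyadicSquarefree X).card ≤ ⌊2 * X⌋₊ + 1 := by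
        exact (Finset.card_filter_le _ _).trans_eq (Finset.card_range _)
      have h6 := Nat.floor_le (show 0 ≤ 2 * X by positivity)
      have h7 : ((dyadicSquarefree X).card : ℝ) ≤ ⌊2 * X⌋₊ + 1 := by exact_mod_cast h5
      linarith
    calc _ ≤ (3 * X) * X ^ ((1 / 2 - e (m + 1) + δ) * k) := by gcongr
      _ = 3 * X ^ (1 + (1 / 2 - c + δ) * k) := by
          rw [hem, Real.rpow_add hX0, Real.rpow_one]; ring
      _ ≤ 3 * Z := by
          gcongr
          exact hexp (by linarith)
  calc ∑ d ∈ dyadicSquarefree X, (hneg g d : ℝ) ^ k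
      ≤ ∑ d ∈ dyadicSquarefree X,
        ((∑ j ∈ Finset.range (m + 2), if d ∈ F j then X ^ ((1 / 2 + δ) * k) else 0)
        + (∑ j ∈ Finset.range (m + 1), if d ∈ B (j + 1) then X ^ ((1 / 2 - e j + δ) * k) else 0)
        + X ^ ((1 / 2 - e (m + 1) + δ) * k)) := Finset.sum_le_sum hpoint
    _ = (∑ j ∈ Finset.range (m + 2), ∑ d ∈ dyadicSquarefree X,
          if d ∈ F j then X ^ ((1 / 2 + δ) * k) else 0)
        + (∑ j ∈ Finset.range (m + 1), ∑ d ∈ dyadicSquarefree X,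
          if d ∈ B (j + 1) then X ^ ((1 / 2 - e j + δ) * k) else 0)
        + (dyadicSquarefree X).card * X ^ ((1 / 2 - e (m + 1) + δ) * k) := by
        rw [Finset.sum_add_distrib, Finset.sum_add_distrib, Finset.sum_const, nsmul_eq_mul]
        congr 1
        exact congrArg₂ _ Finset.sum_comm Finset.sum_comm
    _ ≤ (∑ j ∈ Finset.range (m + 2), Z) + (∑ j ∈ Finset.range (m + 1), 2 * Z) + 3 * Z := by
        refine add_le_add (add_le_add (Finset.sum_le_sum fun j hj => ?_)
          (Finset.sum_le_sum fun j hj => ?_)) hT3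
        · exact (hind _ _ _ (by positivity)).trans (hT1 j hj)
        · exact (hind _ _ _ (by positivity)).trans (hT2 j hj)
    _ = ((m + 2) + (m + 1) * 2 + 3) * Z := by
        rw [Finset.sum_const, Finset.sum_const, Finset.card_range, Finset.card_range,
          nsmul_eq_mul, nsmul_eq_mul]
        push_cast
        ring
    _ ≤ X ^ (E + ε) := hXE

/-- The moment bound with an exponent dominating the three competing ones. -/
theorem exists_sum_hneg_rpow_le {g : ℕ} (hg : 2 ≤ g) {k E ε : ℝ} (hk : 0 ≤ k) (hε : 0 < ε)
    (hE : 1 ≤ E) (hA : 1 + k * ((g : ℝ) - 2) / (2 * g + 2) ≤ E)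
    (hB : 1 + k * ((g : ℝ) - 1) / (2 * g) - ((g : ℝ) - 1) / (2 * g) ≤ E) (hC : k / 2 ≤ E) :
    ∃ C : ℝ, 0 < C ∧ ∀ X : ℝ, 2 ≤ X →
      ∑ d ∈ (Finset.range (⌈X⌉₊ + 1)).filter
          (fun d : ℕ => Squarefree d ∧ 0 < d ∧ (d : ℝ) < X),
        (hneg g d : ℝ) ^ k ≤ C * X ^ (E + ε) := by
  have hgR : (2 : ℝ) ≤ g := by exact_mod_cast hg
  have hg0 : (0 : ℝ) < g := by linarith
  have hac : 1 / (2 * (g : ℝ)) < 3 / (2 * g + 2) := by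
    rw [div_lt_div_iff₀ (by positivity) (by positivity)]
    linarith
  have hlin : ∀ {u v a c : ℝ}, a < c → u + v * a ≤ E → u + v * c ≤ E →
      ∀ x, a ≤ x → x ≤ c → u + v * x ≤ E := by
    intro u v a c hac ha hc x hax hxc
    rcases le_total 0 v with hv | hv <;> nlinarith
  have hA' : 1 + k * (1 / 2 - 3 / (2 * (g : ℝ) + 2)) ≤ E := by
    refine le_trans (le_of_eq ?_) hA
    field_simp
    ring
  have hB' : 1 / 2 + 1 / (2 * (g : ℝ)) + k * (1 / 2 - 1 / (2 * g)) ≤ E := by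
    refine le_trans (le_of_eq ?_) hB
    field_simp
    ring
  have hdy := eventually_sum_dyadic_le (g := g) (by omega) (a := 1 / (2 * g)) (c := 3 / (2 * g + 2))
    (E := E) hk hε (by field_simp) hac
    (fun x hx hx' => by
      have := hlin (u := 1 / 2 + k / 2) (v := 1 - k) hac (by linarith) (by
        have : 3 / (2 * (g : ℝ) + 2) ≤ 1 / 2 := by
          rw [div_le_div_iff₀ (by positivity) (by positivity)]
          linarith
        linarith) x hx hx'
      linarith)
    (fun x hx hx' => by
      have := hlin (u := -1 / 2 + k / 2) (v := g + 1 - k) hac (by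
        have : ((g : ℝ) + 1) * (1 / (2 * g)) = 1 / 2 + 1 / (2 * g) := by field_simp
        have : 1 / (2 * (g : ℝ)) ≤ 1 := by
          rw [div_le_one (by positivity)]
          linarith
        linarith) (by
        have : ((g : ℝ) + 1) * (3 / (2 * g + 2)) = 3 / 2 := by field_simp
        linarith) x hx hx'
      linarith)
    hA' hC
  have hpow : Filter.Tendsto (fun n : ℕ => (2 : ℝ) ^ n) Filter.atTop Filter.atTop :=
    tendsto_pow_atTop_atTop_of_one_lt (by norm_num)
  obtain ⟨C, hC0, hCn⟩ := exists_le_mul_of_eventually_le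
    (v := fun n : ℕ => ((2 : ℝ) ^ n) ^ (E + ε))
    (fun n => Real.one_le_rpow (one_le_pow₀ (by norm_num)) (by linarith)) (hpow.eventually hdy)
  have hsum : ∀ n : ℕ, ∑ d ∈ (Finset.range (2 ^ n)).filter (fun d => Squarefree d),
      (hneg g d : ℝ) ^ k ≤ C * ((2 : ℝ) ^ n) ^ (E + ε) := by
    intro n
    induction n with
    | zero =>
      rw [pow_zero, Finset.range_one, Finset.sum_filter, Finset.sum_singleton,
        if_neg not_squarefree_zero]
      positivity
    | succ n ih =>
      have hsub : (Finset.range (2 ^ (n + 1))).filter (fun d => Squarefree d)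
          ⊆ (Finset.range (2 ^ n)).filter (fun d => Squarefree d)
            ∪ dyadicSquarefree ((2 : ℝ) ^ n) := by
        intro d hd
        rw [Finset.mem_filter, Finset.mem_range] at hd
        rw [Finset.mem_union, Finset.mem_filter, Finset.mem_range, dyadicSquarefree,
          Finset.mem_filter, Finset.mem_range]
        by_cases hdn : d < 2 ^ n
        · exact Or.inl ⟨hdn, hd.2⟩
        · have h5 : (d : ℝ) < 2 * 2 ^ n := by
            rw [← pow_succ']
            exact_mod_cast hd.1
          refine Or.inr ⟨Nat.lt_succ_of_le (Nat.le_floor h5.le), hd.2, ?_, h5⟩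
          exact_mod_cast not_lt.mp hdn
      have h6 : (2 : ℝ) ≤ 2 ^ (E + ε) := by
        calc (2 : ℝ) = 2 ^ (1 : ℝ) := (Real.rpow_one 2).symm
          _ ≤ 2 ^ (E + ε) := Real.rpow_le_rpow_of_exponent_le (by norm_num) (by linarith)
      calc _ ≤ ∑ d ∈ (Finset.range (2 ^ n)).filter (fun d => Squarefree d)
            ∪ dyadicSquarefree ((2 : ℝ) ^ n), (hneg g d : ℝ) ^ k :=
            Finset.sum_le_sum_of_subset_of_nonneg hsub fun _ _ _ => by positivity
        _ ≤ (∑ d ∈ (Finset.range (2 ^ n)).filter (fun d => Squarefree d), (hneg g d : ℝ) ^ k)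
            + ∑ d ∈ dyadicSquarefree ((2 : ℝ) ^ n), (hneg g d : ℝ) ^ k := by
            rw [← Finset.sum_union_inter]
            exact le_add_of_nonneg_right (Finset.sum_nonneg fun _ _ => by positivity)
        _ ≤ C * ((2 : ℝ) ^ n) ^ (E + ε) + C * ((2 : ℝ) ^ n) ^ (E + ε) := add_le_add ih (hCn n)
        _ = C * (2 * ((2 : ℝ) ^ n) ^ (E + ε)) := by ring
        _ ≤ C * (2 ^ (E + ε) * ((2 : ℝ) ^ n) ^ (E + ε)) := by gcongr
        _ = _ := by
            rw [← Real.mul_rpow (by norm_num) (by positivity), ← pow_succ']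
  refine ⟨C * 2 ^ (E + ε), by positivity, fun X hX => ?_⟩
  obtain ⟨n, hn1, hn2⟩ := exists_nat_pow_near (show 1 ≤ X by linarith) (show (1 : ℝ) < 2 by norm_num)
  calc _ ≤ ∑ d ∈ (Finset.range (2 ^ (n + 1))).filter (fun d => Squarefree d),
        (hneg g d : ℝ) ^ k := by
        refine Finset.sum_le_sum_of_subset_of_nonneg (fun d hd => ?_) fun _ _ _ => by positivity
        rw [Finset.mem_filter] at hd ⊢
        refine ⟨Finset.mem_range.mpr ?_, hd.2.1⟩
        exact_mod_cast hd.2.2.2.trans hn2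
    _ ≤ C * ((2 : ℝ) ^ (n + 1)) ^ (E + ε) := hsum _
    _ ≤ C * (2 * X) ^ (E + ε) := by
        rw [pow_succ']
        gcongr
    _ = C * 2 ^ (E + ε) * X ^ (E + ε) := by
        rw [Real.mul_rpow (by norm_num) (by linarith)]; ring

/-- Let `g ≥ 5` be a prime and `k ≥ 1` real.  For every `ε > 0` there is
`C = C(g, k, ε)` such that for all `X ≥ 2`, the sum of `h_g(-d)^k` over
squarefree `0 < d < X` is at most `C · X^(1 + k(g-2)/(2g+2) + ε)` if
`1 ≤ k ≤ (g²-1)/(2g-1)`, at most `C · X^(1 + k(g-1)/(2g) - (g-1)/(2g) + ε)` if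
`(g²-1)/(2g-1) ≤ k ≤ g+1`, and at most `C · X^(k/2 + ε)` if `k ≥ g+1`. -/
theorem kth_moment_hg_bound (g : ℕ) (hg : g.Prime) (hg5 : 5 ≤ g)
    (k : ℝ) (hk : 1 ≤ k) (ε : ℝ) (hε : 0 < ε) :
    ∃ C : ℝ, 0 < C ∧ ∀ X : ℝ, 2 ≤ X →
      (k ≤ ((g : ℝ) ^ 2 - 1) / (2 * g - 1) →
        ∑ d ∈ (Finset.range (⌈X⌉₊ + 1)).filter
            (fun d : ℕ => Squarefree d ∧ 0 < d ∧ (d : ℝ) < X),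
          (hneg g d : ℝ) ^ k
        ≤ C * X ^ (1 + k * ((g : ℝ) - 2) / (2 * g + 2) + ε)) ∧
      (((g : ℝ) ^ 2 - 1) / (2 * g - 1) ≤ k → k ≤ (g : ℝ) + 1 →
        ∑ d ∈ (Finset.range (⌈X⌉₊ + 1)).filter
            (fun d : ℕ => Squarefree d ∧ 0 < d ∧ (d : ℝ) < X),
          (hneg g d : ℝ) ^ k
        ≤ C * X ^ (1 + k * ((g : ℝ) - 1) / (2 * g) - ((g : ℝ) - 1) / (2 * g) + ε)) ∧
      ((g : ℝ) + 1 ≤ k →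
        ∑ d ∈ (Finset.range (⌈X⌉₊ + 1)).filter
            (fun d : ℕ => Squarefree d ∧ 0 < d ∧ (d : ℝ) < X),
          (hneg g d : ℝ) ^ k
        ≤ C * X ^ (k / 2 + ε)) := by
  have hgR : (5 : ℝ) ≤ g := by exact_mod_cast hg5
  have hg0 : (0 : ℝ) < g := by linarith
  have eA : 1 + k * ((g : ℝ) - 2) / (2 * g + 2) = 1 + k * (1 / 2 - 3 / (2 * g + 2)) := by
    field_simp
    ring
  have eB : 1 + k * ((g : ℝ) - 1) / (2 * g) - ((g : ℝ) - 1) / (2 * g)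
      = 1 / 2 + 1 / (2 * g) + k * (1 / 2 - 1 / (2 * g)) := by
    field_simp
    ring
  set u := 1 / (2 * (g : ℝ)) with hu
  set v := 3 / (2 * (g : ℝ) + 2) with hv
  have hu0 : 0 < u := by positivity
  have hug : g * u = 1 / 2 := by rw [hu]; field_simp
  have hvg : (g + 1) * v = 3 / 2 := by rw [hv]; field_simp
  have hv2 : v ≤ 1 / 4 := by nlinarith
  have hu2 : u ≤ 1 / 10 := by nlinarith
  have huv : 0 < v - u := by nlinarith
  have hden : (0 : ℝ) < 2 * g - 1 := by linarith
  have huv' : ((g : ℝ) ^ 2 - 1) / (2 * g - 1) * (v - u) = 1 / 2 - u := by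
    rw [div_mul_eq_mul_div, div_eq_iff hden.ne']
    linear_combination ((g : ℝ) - 1) * hvg + (2 - (g : ℝ)) * hug
  have hAB : k ≤ ((g : ℝ) ^ 2 - 1) / (2 * g - 1) → k * (v - u) ≤ 1 / 2 - u := fun h => by
    rw [← huv']
    gcongr
  have hBA : ((g : ℝ) ^ 2 - 1) / (2 * g - 1) ≤ k → 1 / 2 - u ≤ k * (v - u) := fun h => by
    rw [← huv']
    gcongr
  have hkv : k ≤ ((g : ℝ) ^ 2 - 1) / (2 * g - 1) → k * v ≤ 1 := fun h => by
    have h1 : k * (2 * g - 1) ≤ (g : ℝ) ^ 2 - 1 := (le_div_iff₀ hden).mp h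
    have h2 : 3 * k ≤ 2 * ((g : ℝ) + 1) := by nlinarith
    nlinarith
  have hku : ((g : ℝ) + 1) * u = 1 / 2 + u := by linarith
  have hkv0 : k * (1 / 2 - v) ≥ 0 := mul_nonneg (by linarith) (by linarith)
  have hku0 : 1 * (1 / 2 - u) ≤ k * (1 / 2 - u) := mul_le_mul_of_nonneg_right hk (by linarith)
  have of_imp : ∀ {R : Prop} {E : ℝ}, (R → 1 ≤ E ∧ 1 + k * ((g : ℝ) - 2) / (2 * g + 2) ≤ E ∧
      1 + k * ((g : ℝ) - 1) / (2 * g) - ((g : ℝ) - 1) / (2 * g) ≤ E ∧ k / 2 ≤ E) →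
      ∃ C : ℝ, 0 < C ∧ ∀ X : ℝ, 2 ≤ X → R →
        ∑ d ∈ (Finset.range (⌈X⌉₊ + 1)).filter
            (fun d : ℕ => Squarefree d ∧ 0 < d ∧ (d : ℝ) < X),
          (hneg g d : ℝ) ^ k ≤ C * X ^ (E + ε) := by
    intro R E h
    by_cases hR : R
    · obtain ⟨h1, h2, h3, h4⟩ := h hR
      obtain ⟨C, hC, hCX⟩ := exists_sum_hneg_rpow_le (by omega) (zero_le_one.trans hk) hε h1 h2 h3 h4
      exact ⟨C, hC, fun X hX _ => hCX X hX⟩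
    · exact ⟨1, one_pos, fun _ _ h => absurd h hR⟩
  obtain ⟨C₁, h₁, hC₁⟩ := of_imp (R := k ≤ ((g : ℝ) ^ 2 - 1) / (2 * g - 1))
    (E := 1 + k * ((g : ℝ) - 2) / (2 * g + 2)) fun h => by
      have h1 := hAB h
      have h2 := hkv h
      rw [eA, eB]
      refine ⟨?_, ?_, ?_, ?_⟩ <;> linarith
  obtain ⟨C₂, h₂, hC₂⟩ := of_imp (R := ((g : ℝ) ^ 2 - 1) / (2 * g - 1) ≤ k ∧ k ≤ (g : ℝ) + 1)
    (E := 1 + k * ((g : ℝ) - 1) / (2 * g) - ((g : ℝ) - 1) / (2 * g)) fun h => by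
      have h1 := hBA h.1
      have h2 := mul_le_mul_of_nonneg_right h.2 hu0.le
      rw [eA, eB]
      refine ⟨?_, ?_, ?_, ?_⟩ <;> linarith
  obtain ⟨C₃, h₃, hC₃⟩ := of_imp (R := (g : ℝ) + 1 ≤ k) (E := k / 2) fun h => by
      have h1 := mul_le_mul_of_nonneg_right h hu0.le
      have h2 := mul_le_mul_of_nonneg_right h (show 0 ≤ v by positivity)
      rw [eA, eB]
      refine ⟨?_, ?_, ?_, ?_⟩ <;> linarith
  refine ⟨C₁ + C₂ + C₃, by positivity, fun X hX => ⟨fun h => ?_, fun h h' => ?_, fun h => ?_⟩⟩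
  · refine (hC₁ X hX h).trans ?_
    gcongr
    linarith
  · refine (hC₂ X hX ⟨h, h'⟩).trans ?_
    gcongr
    linarith
  · refine (hC₃ X hX h).trans ?_
    gcongr
    linarith
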